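/- arXiv:2011.03013 — 4 statements merged into one kernel-verified Lean document; each statement's English description precedes it below -/
import Mathlib

section
/- Let c = 1/800, let n be sufficiently large, and let p ≤ exp(c·√(n·log n)) be a prime. Then for every β with n/(2p) ≤ β ≤ 2n/p, one has Σ_{v ∈ (ℤ/pℤ)^n \ {0}, ρ(v) ≥ β} max_{w ∈ (ℤ/pℤ)^n} P(M_n·v = w) ≤ e^{-c·n}. -/
/-- `probX μ v x` is the probability that the random walk `X_μ(v) = ε₁v₁ + ⋯ + εₙvₙ`
(valued in `ℤ/pℤ`) equals `x`, where `ε₁,…,εₙ` are i.i.d. with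
`P(εᵢ = 1) = P(εᵢ = -1) = μ/2` and `P(εᵢ = 0) = 1 - μ`. -/
noncomputable def probX {p : ℕ} [NeZero p] {ι : Type} [Fintype ι] [DecidableEq ι]
    (μ : ℝ) (v : ι → ZMod p) (x : ZMod p) : ℝ :=
  ∑ ε : ι → ({-1, 0, 1} : Finset ℤ),
    (∏ i, if (ε i : ℤ) = 0 then 1 - μ else μ / 2) *
      (if (∑ i, ((ε i : ℤ) : ZMod p) * v i) = x then 1 else 0)

/-- `rho μ v = max_x P(X_μ(v) = x)`, the largest atom of the random walk `X_μ(v)`. -/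
noncomputable def rho {p : ℕ} [NeZero p] {ι : Type} [Fintype ι] [DecidableEq ι]
    (μ : ℝ) (v : ι → ZMod p) : ℝ :=
  ⨆ x : ZMod p, probX μ v x
/-- `symPr n E` is the probability that a uniformly random `n × n` symmetric matrix
with entries in `{-1, 1}` lies in the event `E`. -/
noncomputable def symPr (n : ℕ) (E : Set (Matrix (Fin n) (Fin n) ℤ)) : ℝ :=
  (Nat.card {A : Matrix (Fin n) (Fin n) ℤ |
      (A.IsSymm ∧ ∀ i j, A i j = 1 ∨ A i j = -1) ∧ A ∈ E} : ℝ) /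
  (Nat.card {A : Matrix (Fin n) (Fin n) ℤ |
      A.IsSymm ∧ ∀ i j, A i j = 1 ∨ A i j = -1} : ℝ)


namespace LazyWalk

open Finset

variable {p : ℕ} [Fact p.Prime]

/-- The cosine `cos (4πa/p)`, as a function on `ℤ/pℤ`. -/
noncomputable def dcos (a : ZMod p) : ℝ := (ZMod.stdAddChar (2 * a) : ℂ).re

/-- The characteristic function of a `1/4`-lazy step. -/
noncomputable def lazyFactor (a : ZMod p) : ℝ := 3 / 4 + 1 / 4 * dcos a

variable {ι : Type}

/-- The characteristic function of the `1/4`-lazy walk with steps `v j`, `j ∈ S`. -/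
noncomputable def charFun (v : ι → ZMod p) (S : Finset ι) (ξ : ZMod p) : ℝ :=
  ∏ j ∈ S, lazyFactor (ξ * v j)

/-- The probability that the `1/4`-lazy walk with steps `v j`, `j ∈ S`, is at `x`. -/
noncomputable def lazyProb (v : ι → ZMod p) (S : Finset ι) (x : ZMod p) : ℝ :=
  (∑ ξ : ZMod p, charFun v S ξ * dcos (ξ * x)) / p

/-- The return probability of the `1/4`-lazy walk with steps `v j`, `j ∈ S`. -/
noncomputable def retProb (v : ι → ZMod p) (S : Finset ι) : ℝ :=
  (∑ ξ : ZMod p, charFun v S ξ) / p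

/-- The set of points that the lazy walk hits at least half as often as the origin. -/
noncomputable def nbhd (v : ι → ZMod p) (S : Finset ι) : Finset (ZMod p) :=
  univ.filter fun x => retProb v S / 2 ≤ lazyProb v S x

lemma norm_stdAddChar (a : ZMod p) : ‖(ZMod.stdAddChar a : ℂ)‖ = 1 := AddChar.norm_apply _ _

lemma re_sq_add_im_sq (a : ZMod p) :
    (ZMod.stdAddChar a : ℂ).re ^ 2 + (ZMod.stdAddChar a : ℂ).im ^ 2 = 1 := by
  have h := norm_stdAddChar a
  have h2 := Complex.sq_norm (ZMod.stdAddChar a : ℂ)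
  rw [h, Complex.normSq_apply] at h2
  nlinarith

lemma dcos_zero : dcos (0 : ZMod p) = 1 := by simp [dcos]

lemma dcos_le_one (a : ZMod p) : dcos a ≤ 1 :=
  (Complex.re_le_norm _).trans (norm_stdAddChar _).le

lemma neg_one_le_dcos (a : ZMod p) : -1 ≤ dcos a := by
  have h := re_sq_add_im_sq (2 * a)
  unfold dcos
  nlinarith [sq_nonneg (ZMod.stdAddChar (2 * a) : ℂ).im]

lemma dcos_add_add_dcos_sub (a b : ZMod p) :
    dcos (a + b) + dcos (a - b) = 2 * dcos a * dcos b := by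
  unfold dcos
  rw [mul_add, mul_sub, sub_eq_add_neg, AddChar.map_add_eq_mul, AddChar.map_add_eq_mul,
    AddChar.map_neg_eq_conj]
  simp
  ring

lemma one_sub_dcos_add_le (a b : ZMod p) :
    1 - dcos (a + b) ≤ 2 * (1 - dcos a) + 2 * (1 - dcos b) := by
  unfold dcos
  rw [mul_add, AddChar.map_add_eq_mul, Complex.mul_re]
  have h1 := re_sq_add_im_sq (2 * a)
  have h2 := re_sq_add_im_sq (2 * b)
  set x := (ZMod.stdAddChar (2 * a) : ℂ).re
  set y := (ZMod.stdAddChar (2 * a) : ℂ).im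
  set s := (ZMod.stdAddChar (2 * b) : ℂ).re
  set t := (ZMod.stdAddChar (2 * b) : ℂ).im
  have h3 : (x ^ 2 + y ^ 2) * (s ^ 2 + t ^ 2) = 1 := by rw [h1, h2]; norm_num
  have h4 : 0 ≤ (1 - 2 * x + (x * s - y * t)) ^ 2 + (-2 * y + (x * t + y * s)) ^ 2 := by positivity
  have h5 : (1 - 2 * x + (x * s - y * t)) ^ 2 + (-2 * y + (x * t + y * s)) ^ 2
      = 1 + 4 * (x ^ 2 + y ^ 2) + (x ^ 2 + y ^ 2) * (s ^ 2 + t ^ 2) - 4 * x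
        + 2 * (x * s - y * t) - 4 * s * (x ^ 2 + y ^ 2) := by ring
  rw [h5, h3, h1] at h4
  linarith

lemma abs_re_le_lazyFactor (a : ZMod p) : |(ZMod.stdAddChar a : ℂ).re| ≤ lazyFactor a := by
  unfold lazyFactor dcos
  rw [two_mul, AddChar.map_add_eq_mul, Complex.mul_re]
  have h1 := re_sq_add_im_sq a
  rw [abs_le]
  constructor
  · nlinarith [sq_nonneg ((ZMod.stdAddChar a : ℂ).re + 1)]
  · nlinarith [sq_nonneg ((ZMod.stdAddChar a : ℂ).re - 1)]

lemma half_le_lazyFactor (a : ZMod p) : 1 / 2 ≤ lazyFactor a := by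
  unfold lazyFactor; linarith [neg_one_le_dcos a]

lemma lazyFactor_nonneg (a : ZMod p) : 0 ≤ lazyFactor a := by
  linarith [half_le_lazyFactor a]

lemma lazyFactor_le_one (a : ZMod p) : lazyFactor a ≤ 1 := by
  unfold lazyFactor; linarith [dcos_le_one a]

lemma lazyFactor_zero : lazyFactor (0 : ZMod p) = 1 := by
  unfold lazyFactor; rw [dcos_zero]; norm_num

lemma sum_stdAddChar (x : ZMod p) :
    ∑ ξ : ZMod p, (ZMod.stdAddChar (ξ * x) : ℂ) = if x = 0 then (p : ℂ) else 0 := by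
  rw [AddChar.sum_mulShift x (ZMod.isPrimitive_stdAddChar p)]
  split_ifs <;> simp [ZMod.card]

lemma two_ne_zero_of_ne (hp : p ≠ 2) : (2 : ZMod p) ≠ 0 := by
  intro h
  have : ((2 : ℕ) : ZMod p) = 0 := by exact_mod_cast h
  rw [ZMod.natCast_eq_zero_iff] at this
  exact hp ((Nat.prime_dvd_prime_iff_eq Fact.out Nat.prime_two).1 this)

lemma sum_dcos (hp : p ≠ 2) (x : ZMod p) :
    ∑ ξ : ZMod p, dcos (ξ * x) = if x = 0 then (p : ℝ) else 0 := by
  have h := congrArg Complex.re (sum_stdAddChar (2 * x))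
  rw [Complex.re_sum] at h
  simp only [mul_eq_zero, two_ne_zero_of_ne hp, false_or] at h
  unfold dcos
  rw [sum_congr rfl fun ξ _ => by rw [mul_left_comm], h]
  split_ifs <;> simp

lemma charFun_nonneg (v : ι → ZMod p) (S : Finset ι) (ξ : ZMod p) : 0 ≤ charFun v S ξ :=
  prod_nonneg fun _ _ => lazyFactor_nonneg _

lemma charFun_le_one (v : ι → ZMod p) (S : Finset ι) (ξ : ZMod p) : charFun v S ξ ≤ 1 :=
  prod_le_one (fun _ _ => lazyFactor_nonneg _) fun _ _ => lazyFactor_le_one _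

lemma charFun_zero (v : ι → ZMod p) (S : Finset ι) : charFun v S 0 = 1 := by
  simp [charFun, lazyFactor_zero]

lemma charFun_anti (v : ι → ZMod p) {S T : Finset ι} (h : S ⊆ T) (ξ : ZMod p) :
    charFun v T ξ ≤ charFun v S ξ := by
  classical
  unfold charFun
  rw [← prod_sdiff h]
  exact mul_le_of_le_one_left (charFun_nonneg v S ξ) (charFun_le_one v (T \ S) ξ)

lemma natCast_pos : (0 : ℝ) < p := by exact_mod_cast (Fact.out : p.Prime).pos

lemma retProb_anti (v : ι → ZMod p) {S T : Finset ι} (h : S ⊆ T) :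
    retProb v T ≤ retProb v S := by
  unfold retProb
  gcongr with ξ
  exact charFun_anti v h ξ

lemma retProb_le_one (v : ι → ZMod p) (S : Finset ι) : retProb v S ≤ 1 := by
  unfold retProb
  rw [div_le_one natCast_pos]
  refine (sum_le_sum fun ξ _ => charFun_le_one v S ξ).trans ?_
  simp [ZMod.card]

lemma one_div_le_retProb (v : ι → ZMod p) (S : Finset ι) : 1 / (p : ℝ) ≤ retProb v S := by
  unfold retProb
  gcongr
  rw [← charFun_zero v S]
  exact single_le_sum (fun ξ _ => charFun_nonneg v S ξ) (mem_univ 0)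

lemma retProb_pos (v : ι → ZMod p) (S : Finset ι) : 0 < retProb v S :=
  (one_div_pos.2 natCast_pos).trans_le (one_div_le_retProb v S)

lemma retProb_empty (v : ι → ZMod p) : retProb v ∅ = 1 := by
  simp [retProb, charFun, ZMod.card, natCast_pos.ne']

lemma retProb_congr {v u : ι → ZMod p} {S : Finset ι} (h : ∀ j ∈ S, v j = u j) :
    retProb v S = retProb u S := by
  unfold retProb charFun
  congr 1
  exact sum_congr rfl fun ξ _ => prod_congr rfl fun j hj => by rw [h j hj]

lemma nbhd_congr {v u : ι → ZMod p} {S : Finset ι} (h : ∀ j ∈ S, v j = u j) :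
    nbhd v S = nbhd u S := by
  have h1 : charFun v S = charFun u S := by
    funext ξ
    exact prod_congr rfl fun j hj => by rw [h j hj]
  unfold nbhd retProb lazyProb
  rw [h1]

lemma lazyProb_zero (v : ι → ZMod p) (S : Finset ι) : lazyProb v S 0 = retProb v S := by
  simp [lazyProb, retProb, dcos_zero]

lemma zero_mem_nbhd (v : ι → ZMod p) (S : Finset ι) : 0 ∈ nbhd v S := by
  simp only [nbhd, mem_filter, mem_univ, true_and, lazyProb_zero]
  linarith [retProb_pos v S]

lemma retProb_insert [DecidableEq ι] (v : ι → ZMod p) {S : Finset ι} {i : ι} (hi : i ∉ S) :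
    retProb v (insert i S) = 3 / 4 * retProb v S + 1 / 4 * lazyProb v S (v i) := by
  have h : ∀ ξ, charFun v (insert i S) ξ =
      3 / 4 * charFun v S ξ + 1 / 4 * (charFun v S ξ * dcos (ξ * v i)) := by
    intro ξ
    unfold charFun
    rw [prod_insert hi, lazyFactor]
    ring
  unfold retProb lazyProb
  rw [sum_congr rfl fun ξ _ => h ξ, sum_add_distrib, ← mul_sum, ← mul_sum]
  ring

lemma lazyProb_nonneg [DecidableEq ι] (hp : p ≠ 2) (v : ι → ZMod p) (S : Finset ι) :
    ∀ x, 0 ≤ lazyProb v S x := by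
  induction S using Finset.induction_on with
  | empty =>
    intro x
    simp only [lazyProb, charFun, prod_empty, one_mul, sum_dcos hp]
    split_ifs <;> positivity
  | insert i S hi ih =>
    intro x
    have h : ∀ ξ, charFun v (insert i S) ξ * dcos (ξ * x) =
        3 / 4 * (charFun v S ξ * dcos (ξ * x)) +
          1 / 8 * (charFun v S ξ * dcos (ξ * (x + v i)) + charFun v S ξ * dcos (ξ * (x - v i))) := by
      intro ξ
      have h2 := dcos_add_add_dcos_sub (ξ * x) (ξ * v i)
      unfold charFun
      rw [prod_insert hi, lazyFactor, mul_add ξ x, mul_sub ξ x]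
      linear_combination (- (1 / 8) * ∏ j ∈ S, lazyFactor (ξ * v j)) * h2
    have h3 : lazyProb v (insert i S) x = 3 / 4 * lazyProb v S x +
        1 / 8 * (lazyProb v S (x + v i) + lazyProb v S (x - v i)) := by
      unfold lazyProb
      rw [sum_congr rfl fun ξ _ => h ξ, sum_add_distrib, ← mul_sum, ← mul_sum, sum_add_distrib]
      ring
    rw [h3]
    linarith [ih x, ih (x + v i), ih (x - v i)]

lemma sum_lazyProb (hp : p ≠ 2) (v : ι → ZMod p) (S : Finset ι) : ∑ x, lazyProb v S x = 1 := by
  unfold lazyProb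
  rw [← sum_div, sum_comm, div_eq_one_iff_eq natCast_pos.ne']
  have : ∀ ξ : ZMod p, ∑ x, charFun v S ξ * dcos (ξ * x) = if ξ = 0 then (p : ℝ) else 0 := by
    intro ξ
    rw [← mul_sum, sum_congr rfl fun x _ => by rw [mul_comm ξ x], sum_dcos hp]
    split_ifs with h
    · rw [h, charFun_zero, one_mul]
    · simp
  rw [sum_congr rfl fun ξ _ => this ξ]
  simp

lemma card_nbhd_mul_retProb_le [DecidableEq ι] (hp : p ≠ 2) (v : ι → ZMod p) (S : Finset ι) :
    ((nbhd v S).card : ℝ) * retProb v S ≤ 2 := by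
  have h1 : ∑ x ∈ nbhd v S, retProb v S / 2 ≤ ∑ x ∈ nbhd v S, lazyProb v S x :=
    sum_le_sum fun x hx => (mem_filter.1 hx).2
  have h2 : ∑ x ∈ nbhd v S, lazyProb v S x ≤ ∑ x, lazyProb v S x :=
    sum_le_sum_of_subset_of_nonneg (subset_univ _) fun x _ _ => lazyProb_nonneg hp v S x
  rw [sum_lazyProb hp] at h2
  rw [sum_const, nsmul_eq_mul] at h1
  linarith

lemma retProb_le_of_ne_zero [DecidableEq ι] (hp : p ≠ 2) (v : ι → ZMod p) {S : Finset ι} {i : ι}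
    (hi : i ∈ S) (hv : v i ≠ 0) : retProb v S ≤ 3 / 4 := by
  refine (retProb_anti v (singleton_subset_iff.2 hi)).trans ?_
  rw [← insert_empty_eq, retProb_insert v (notMem_empty i), retProb_empty]
  simp [lazyProb, charFun, sum_dcos hp, hv]

lemma stdAddChar_sum [Fintype ι] (u : ι → ZMod p) :
    (ZMod.stdAddChar (∑ i, u i) : ℂ) = ∏ i, ZMod.stdAddChar (u i) := by
  classical
  refine Finset.induction_on univ (by simp) fun i S hi ih => ?_
  rw [sum_insert hi, prod_insert hi, AddChar.map_add_eq_mul, ih]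

/-- A random walk whose steps have characteristic function dominated by the `1/4`-lazy one has
no atom larger than the return probability of the lazy walk. -/
lemma atom_le_retProb [Fintype ι] [DecidableEq ι] {α : Type} [Fintype α] (wt : α → ℝ) (s : α → ℤ)
    (h : ∀ a : ZMod p, ‖∑ e, (wt e : ℂ) * (ZMod.stdAddChar (((s e : ℤ) : ZMod p) * a) : ℂ)‖
      ≤ lazyFactor a) (v : ι → ZMod p) (x : ZMod p) :
    ∑ ε : ι → α, (∏ i, wt (ε i)) * (if ∑ i, ((s (ε i) : ℤ) : ZMod p) * v i = x then 1 else 0)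
      ≤ retProb v univ := by
  have hp0 : (p : ℂ) ≠ 0 := by exact_mod_cast (natCast_pos (p := p)).ne'
  have hind : ∀ y : ZMod p, ((if y = x then 1 else 0 : ℝ) : ℂ) =
      (∑ ξ : ZMod p, (ZMod.stdAddChar (ξ * y) : ℂ) * ZMod.stdAddChar (-(ξ * x))) / p := by
    intro y
    rw [sum_congr rfl fun ξ _ => by rw [← AddChar.map_add_eq_mul, ← sub_eq_add_neg, ← mul_sub],
      sum_stdAddChar]
    by_cases hy : y = x
    · simp [hy, hp0]
    · simp [hy, sub_eq_zero]
  have hfact : ∀ ξ : ZMod p, ∑ ε : ι → α, (∏ i, (wt (ε i) : ℂ)) *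
      ZMod.stdAddChar (ξ * ∑ i, ((s (ε i) : ℤ) : ZMod p) * v i) =
      ∏ i, ∑ e, (wt e : ℂ) * (ZMod.stdAddChar (((s e : ℤ) : ZMod p) * (ξ * v i)) : ℂ) := by
    intro ξ
    rw [Fintype.prod_sum]
    refine sum_congr rfl fun ε _ => ?_
    rw [prod_mul_distrib, mul_sum, stdAddChar_sum]
    congr 1
    exact prod_congr rfl fun i _ => by rw [mul_left_comm]
  have hkey : ((∑ ε : ι → α, (∏ i, wt (ε i)) *
      (if ∑ i, ((s (ε i) : ℤ) : ZMod p) * v i = x then 1 else 0) : ℝ) : ℂ) =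
      (∑ ξ : ZMod p, ZMod.stdAddChar (-(ξ * x)) *
        ∏ i, ∑ e, (wt e : ℂ) * (ZMod.stdAddChar (((s e : ℤ) : ZMod p) * (ξ * v i)) : ℂ)) / p := by
    rw [Complex.ofReal_sum]
    simp_rw [Complex.ofReal_mul, hind, Complex.ofReal_prod, ← hfact, mul_div_assoc', ← sum_div,
      mul_sum]
    rw [sum_comm]
    congr 1
    refine sum_congr rfl fun ξ _ => sum_congr rfl fun ε _ => ?_
    rw [← mul_sum]
    ring
  refine (Real.le_norm_self _).trans ?_
  rw [← Complex.norm_real, hkey, norm_div, Complex.norm_natCast]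
  unfold retProb
  gcongr
  refine (norm_sum_le _ _).trans (sum_le_sum fun ξ _ => ?_)
  rw [norm_mul, norm_stdAddChar, one_mul, norm_prod]
  exact prod_le_prod (fun _ _ => norm_nonneg _) fun i _ => h _

lemma half_add_half_stdAddChar (a : ZMod p) :
    ‖(1 / 2 : ℂ) * ZMod.stdAddChar a + 1 / 2 * ZMod.stdAddChar (-a)‖ ≤ lazyFactor a := by
  rw [AddChar.map_neg_eq_conj, ← mul_add, Complex.add_conj]
  refine le_trans (le_of_eq ?_) (abs_re_le_lazyFactor a)
  rw [← Real.norm_eq_abs, ← Complex.norm_real]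
  congr 1
  push_cast
  ring

lemma rho_one_le_retProb [Fintype ι] [DecidableEq ι] (v : ι → ZMod p) :
    rho 1 v ≤ retProb v univ := by
  refine ciSup_le fun x => ?_
  have h := atom_le_retProb (α := ({-1, 0, 1} : Finset ℤ))
    (fun e => if (e : ℤ) = 0 then 1 - 1 else 1 / 2) (fun e => (e : ℤ)) ?_ v x
  · exact h
  · intro a
    refine le_trans (le_of_eq ?_) (half_add_half_stdAddChar a)
    congr 1
    rw [Finset.sum_coe_sort ({-1, 0, 1} : Finset ℤ) (fun e : ℤ =>
      ((if e = 0 then 1 - 1 else 1 / 2 : ℝ) : ℂ) * (ZMod.stdAddChar ((e : ZMod p) * a) : ℂ))]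
    simp
    ring

lemma card_signs_le [Fintype ι] [DecidableEq ι] (v : ι → ZMod p) (S : Finset ι) (x : ZMod p) :
    ((univ.filter fun ε : ι → ℤˣ =>
      ∑ j ∈ S, (((ε j : ℤˣ) : ℤ) : ZMod p) * v j = x).card : ℝ) ≤
      2 ^ Fintype.card ι * retProb v S := by
  set u : ι → ZMod p := fun j => if j ∈ S then v j else 0 with hu
  have h := atom_le_retProb (α := ℤˣ) (fun _ => 1 / 2) (fun e => (e : ℤ)) ?_ u x
  · have h1 : retProb u univ = retProb v S := by
      unfold retProb charFun
      congr 1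
      refine sum_congr rfl fun ξ _ => ?_
      rw [← prod_subset (subset_univ S)]
      · exact prod_congr rfl fun j hj => by simp [hu, hj]
      · intro j _ hj
        simp [hu, hj, lazyFactor_zero]
    have h2 : ∀ ε : ι → ℤˣ, ∑ i, (((ε i : ℤˣ) : ℤ) : ZMod p) * u i =
        ∑ j ∈ S, (((ε j : ℤˣ) : ℤ) : ZMod p) * v j := by
      intro ε
      simp [hu]
    simp_rw [h2] at h
    rw [h1, ← mul_sum, sum_boole] at h
    simp only [prod_const, card_univ] at h
    rw [one_div, inv_pow, inv_mul_le_iff₀ (by positivity)] at h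
    exact h
  · intro a
    refine le_trans (le_of_eq ?_) (half_add_half_stdAddChar a)
    congr 1
    have : (univ : Finset ℤˣ) = {1, -1} := rfl
    rw [this, sum_pair (by decide)]
    simp

/-- The symmetric sign matrix with prescribed entries on unordered pairs. -/
def signMatrix {n : ℕ} (σ : Sym2 (Fin n) → ℤˣ) : Matrix (Fin n) (Fin n) ℤ :=
  fun i j => (σ s(i, j) : ℤ)

lemma signMatrix_injective {n : ℕ} : Function.Injective (signMatrix (n := n)) := by
  intro σ τ h
  funext e
  induction e with
  | _ i j => exact Units.ext (congrFun (congrFun h i) j)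

lemma image_signMatrix {n : ℕ} (E : Set (Matrix (Fin n) (Fin n) ℤ)) :
    {A : Matrix (Fin n) (Fin n) ℤ | (A.IsSymm ∧ ∀ i j, A i j = 1 ∨ A i j = -1) ∧ A ∈ E} =
      signMatrix '' {σ | signMatrix σ ∈ E} := by
  ext A
  constructor
  · rintro ⟨⟨hs, h1⟩, hE⟩
    have hu : ∀ i j, ∃ u : ℤˣ, (u : ℤ) = A i j := by
      intro i j
      rcases h1 i j with h | h
      · exact ⟨1, by simp [h]⟩
      · exact ⟨-1, by simp [h]⟩
    choose u hu using hu
    have hsymm : ∀ i j, u i j = u j i := fun i j => by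
      apply Units.ext
      rw [hu, hu, hs.apply]
    have hA : signMatrix (Sym2.lift ⟨u, hsymm⟩) = A := by
      ext i j
      simp [signMatrix, hu]
    exact ⟨Sym2.lift ⟨u, hsymm⟩, by simpa [hA] using hE, hA⟩
  · rintro ⟨σ, hσ, rfl⟩
    refine ⟨⟨?_, fun i j => ?_⟩, hσ⟩
    · ext i j
      simp [signMatrix, Sym2.eq_swap]
    · rcases Int.units_eq_one_or (σ s(i, j)) with h | h <;> simp [signMatrix, h]

lemma symPr_eq {n : ℕ} (E : Set (Matrix (Fin n) (Fin n) ℤ)) :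
    symPr n E = (Nat.card {σ : Sym2 (Fin n) → ℤˣ | signMatrix σ ∈ E} : ℝ) /
      2 ^ Fintype.card (Sym2 (Fin n)) := by
  have h2 := image_signMatrix (n := n) Set.univ
  simp only [Set.mem_univ, and_true, Set.ofPred_true] at h2
  unfold symPr
  rw [image_signMatrix, h2, Nat.card_image_of_injective signMatrix_injective,
    Nat.card_image_of_injective signMatrix_injective]
  simp

/-- The unordered pairs containing `i` are indexed by their other element. -/
noncomputable def pairsThrough [DecidableEq ι] (i : ι) : ι ≃ {e : Sym2 ι // i ∈ e} :=
  Equiv.ofBijective (fun j => ⟨s(i, j), Sym2.mem_mk_left i j⟩)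
    ⟨fun j k h => Sym2.congr_right.1 (Subtype.ext_iff.1 h), fun e => by
      obtain ⟨j, hj⟩ := Sym2.mem_iff_exists.1 e.2
      exact ⟨j, Subtype.ext hj.symm⟩⟩

/-- The number of symmetric sign patterns whose principal submatrix on `S` maps `v` to `w`. -/
noncomputable def minorCount [Fintype ι] [DecidableEq ι] (v : ι → ZMod p) (S : Finset ι)
    (w : ι → ZMod p) : ℕ :=
  (univ.filter fun σ : Sym2 ι → ℤˣ =>
    ∀ i ∈ S, ∑ j ∈ S, ((σ s(i, j) : ℤ) : ZMod p) * v j = w i).card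

lemma minorCount_insert_le [Fintype ι] [DecidableEq ι] (v : ι → ZMod p) {S : Finset ι} {a : ι}
    (ha : a ∉ S) {B : ℝ} (hB : ∀ w, (minorCount v S w : ℝ) ≤ 2 ^ Fintype.card (Sym2 ι) * B)
    (w : ι → ZMod p) :
    (minorCount v (insert a S) w : ℝ) ≤ 2 ^ Fintype.card (Sym2 ι) * (retProb v S * B) := by
  classical
  set e := Equiv.piEquivPiSubtypeProd (fun x : Sym2 ι => a ∈ x) (fun _ => ℤˣ) with he
  have hcard : (2 : ℝ) ^ Fintype.card (Sym2 ι) =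
      2 ^ Fintype.card ι * 2 ^ Fintype.card {x : Sym2 ι // a ∉ x} := by
    rw [← pow_add, Fintype.card_congr (pairsThrough a)]
    congr 1
    rw [Fintype.card_subtype_compl]
    have := Fintype.card_subtype_le (fun x : Sym2 ι => a ∈ x)
    omega
  have hleft : ∀ (x : {x : Sym2 ι // a ∈ x} → ℤˣ) y j, e.symm (x, y) s(a, j) =
      x (pairsThrough a j) := by
    intro x y j
    have h : a ∈ s(a, j) := Sym2.mem_mk_left a j
    simp only [he, Equiv.piEquivPiSubtypeProd, Equiv.coe_fn_symm_mk]
    rw [dif_pos h]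
    rfl
  have hright : ∀ (x : {x : Sym2 ι // a ∈ x} → ℤˣ) x' y, ∀ i ∈ S, ∀ j ∈ S,
      e.symm (x, y) s(i, j) = e.symm (x', y) s(i, j) := by
    intro x x' y i hi j hj
    have h : a ∉ s(i, j) := by
      rw [Sym2.mem_iff]
      rintro (rfl | rfl) <;> exact ha ‹_›
    simp only [he, Equiv.piEquivPiSubtypeProd, Equiv.coe_fn_symm_mk]
    rw [dif_neg h, dif_neg h]
  set rest : (ι → ZMod p) → Finset ({x : Sym2 ι // ¬ a ∈ x} → ℤˣ) := fun w' =>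
    univ.filter fun y => ∀ i ∈ S, ∑ j ∈ S, ((e.symm (1, y) s(i, j) : ℤ) : ZMod p) * v j = w' i
    with hrest
  have hrest_le : ∀ w', ((rest w').card : ℝ) ≤ 2 ^ Fintype.card {x : Sym2 ι // a ∉ x} * B := by
    intro w'
    have h1 : minorCount v S w' = 2 ^ Fintype.card ι * (rest w').card := by
      have h2 : 2 ^ Fintype.card ι =
          (univ : Finset ({x : Sym2 ι // a ∈ x} → ℤˣ)).card := by
        rw [card_univ, Fintype.card_fun, Fintype.card_congr (pairsThrough a)]
        rfl
      rw [h2, ← card_product]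
      refine card_equiv e fun σ => ?_
      simp only [mem_filter, mem_univ, true_and, mem_product, hrest]
      refine forall₂_congr fun i hi => ?_
      rw [sum_congr rfl fun j hj => ?_]
      conv_lhs => rw [← e.symm_apply_apply σ]
      rw [← hright (e σ).1 1 (e σ).2 i hi j hj]
    have h3 := hB w'
    rw [h1, hcard] at h3
    push_cast at h3
    rw [mul_assoc] at h3
    exact le_of_mul_le_mul_left h3 (by positivity)
  set rows : Finset ({x : Sym2 ι // a ∈ x} → ℤˣ) := univ.filter fun x =>
    ∑ j ∈ insert a S, ((x (pairsThrough a j) : ℤ) : ZMod p) * v j = w a with hrows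
  have hrows_le : (rows.card : ℝ) ≤ 2 ^ Fintype.card ι * retProb v S := by
    have h1 : rows.card = (univ.filter fun ε : ι → ℤˣ =>
        ∑ j ∈ insert a S, (((ε j : ℤˣ) : ℤ) : ZMod p) * v j = w a).card := by
      refine card_equiv ((pairsThrough a).arrowCongr (Equiv.refl _)).symm fun x => ?_
      simp [hrows]
    rw [h1]
    refine (card_signs_le v (insert a S) (w a)).trans ?_
    gcongr
    exact retProb_anti v (subset_insert a S)
  set shift : ({x : Sym2 ι // a ∈ x} → ℤˣ) → ι → ZMod p := fun x i =>
    w i - ((x (pairsThrough a i) : ℤ) : ZMod p) * v a with hshift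
  have hsub : (univ.filter fun σ : Sym2 ι → ℤˣ => ∀ i ∈ insert a S,
      ∑ j ∈ insert a S, ((σ s(i, j) : ℤ) : ZMod p) * v j = w i).card ≤
      (rows.sigma fun x => rest (shift x)).card := by
    refine card_le_card_of_injOn (fun σ => ⟨(e σ).1, (e σ).2⟩) ?_ ?_
    · intro σ hσ
      simp only [coe_filter, mem_univ, true_and, Set.mem_ofPred_eq] at hσ
      simp only [coe_sigma, Set.mem_sigma_iff, mem_coe, hrows, hrest, mem_filter, mem_univ,
        true_and]
      have hs : ∀ j, σ s(a, j) = (e σ).1 (pairsThrough a j) := by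
        intro j
        rw [← hleft (e σ).1 (e σ).2 j]
        simp
      constructor
      · rw [← hσ a (mem_insert_self a S)]
        exact sum_congr rfl fun j _ => by rw [hs]
      · intro i hi
        have h := hσ i (mem_insert_of_mem hi)
        rw [sum_insert ha, Sym2.eq_swap, hs] at h
        simp only [hshift]
        rw [← h, add_sub_cancel_left]
        refine sum_congr rfl fun j hj => ?_
        rw [hright 1 (e σ).1 (e σ).2 i hi j hj]
        simp
    · intro σ _ τ _ h
      simp only [Sigma.mk.injEq, heq_eq_eq] at h
      exact e.injective (Prod.ext h.1 h.2)
  unfold minorCount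
  calc _ ≤ (((rows.sigma fun x => rest (shift x)).card : ℕ) : ℝ) := by exact_mod_cast hsub
    _ = ∑ x ∈ rows, ((rest (shift x)).card : ℝ) := by rw [card_sigma]; push_cast; rfl
    _ ≤ ∑ x ∈ rows, 2 ^ Fintype.card {x : Sym2 ι // a ∉ x} * B :=
        sum_le_sum fun x _ => hrest_le _
    _ = rows.card * (2 ^ Fintype.card {x : Sym2 ι // a ∉ x} * B) := by
        rw [sum_const, nsmul_eq_mul]
    _ ≤ (2 ^ Fintype.card ι * retProb v S) * (2 ^ Fintype.card {x : Sym2 ι // a ∉ x} * B) := by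
        gcongr
        exact le_trans (by positivity) (hrest_le 0)
    _ = _ := by rw [hcard]; ring

lemma minorCount_le [Fintype ι] [DecidableEq ι] (v : ι → ZMod p) (r : ι → ℕ) (S : Finset ι) :
    ∀ w, (minorCount v S w : ℝ) ≤
      2 ^ Fintype.card (Sym2 ι) * ∏ i ∈ S, retProb v (univ.filter fun j => j ∈ S ∧ r i < r j) := by
  induction S using Finset.induction_on_min_value r with
  | empty =>
    intro w
    simp [minorCount]
  | insert a S ha hmin ih =>
    intro w
    refine (minorCount_insert_le v ha ih w).trans ?_
    rw [prod_insert ha]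
    refine mul_le_mul_of_nonneg_left (mul_le_mul ?_ (le_of_eq ?_) ?_ ?_) (by positivity)
    · refine retProb_anti v fun j hj => ?_
      simp only [mem_filter, mem_univ, true_and, mem_insert] at hj
      rcases hj.1 with rfl | h
      · exact absurd hj.2 (lt_irrefl _)
      · exact h
    · refine prod_congr rfl fun i hi => ?_
      congr 1
      ext j
      simp only [mem_filter, mem_univ, true_and, mem_insert]
      constructor
      · rintro ⟨h1, h2⟩
        exact ⟨Or.inr h1, h2⟩
      · rintro ⟨rfl | h1, h2⟩
        · exact absurd (hmin i hi) (not_le.2 h2)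
        · exact ⟨h1, h2⟩
    · exact prod_nonneg fun i _ => (retProb_pos v _).le
    · exact (retProb_pos v _).le

/-- Revealing the rows in increasing order of rank bounds each atom of `M_n v`. -/
lemma symPr_mulVec_le {n : ℕ} (v w : Fin n → ZMod p) (r : Fin n → ℕ) :
    symPr n {A | (A.map (Int.cast : ℤ → ZMod p)).mulVec v = w} ≤
      ∏ i, retProb v (univ.filter fun j => r i < r j) := by
  rw [symPr_eq, div_le_iff₀ (by positivity), mul_comm]
  have h := minorCount_le v r univ w
  simp only [mem_univ, true_and] at h
  refine le_trans (le_of_eq ?_) h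
  unfold minorCount
  rw [Nat.card_coe_set_eq, Set.ncard_eq_toFinset_card']
  congr 2
  ext σ
  simp [funext_iff, Matrix.mulVec, dotProduct, signMatrix]

lemma integral_indicator_le {a : ℝ} (h0 : 0 ≤ a) (h1 : a ≤ 1) :
    IntervalIntegrable (fun u : ℝ => if u ≤ a then (1 : ℝ) else 0) MeasureTheory.volume 0 1 ∧
      ∫ u in (0 : ℝ)..1, (if u ≤ a then (1 : ℝ) else 0) = a := by
  have hanti : Antitone fun u : ℝ => if u ≤ a then (1 : ℝ) else 0 := by
    intro x y hxy
    by_cases hy : y ≤ a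
    · simp [hy, hxy.trans hy]
    · simp only [hy, if_false]
      split_ifs <;> norm_num
  have hint : ∀ x y : ℝ, IntervalIntegrable (fun u : ℝ => if u ≤ a then (1 : ℝ) else 0)
      MeasureTheory.volume x y := fun x y => (hanti.antitoneOn _).intervalIntegrable
  refine ⟨hint 0 1, ?_⟩
  rw [← intervalIntegral.integral_add_adjacent_intervals (hint 0 a) (hint a 1),
    intervalIntegral.integral_congr_ae (g := fun _ => (1 : ℝ)) ?_,
    intervalIntegral.integral_congr_ae (a := a) (g := fun _ => (0 : ℝ)) ?_]
  · simp
  · refine Filter.Eventually.of_forall fun x hx => ?_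
    rw [Set.uIoc_of_le h1] at hx
    simp [not_le.2 hx.1]
  · refine Filter.Eventually.of_forall fun x hx => ?_
    rw [Set.uIoc_of_le h0] at hx
    simp [hx.2]

/-- A comparison of superlevel sets gives a comparison of sums. -/
lemma sum_le_of_card_superlevel_le {α : Type} [Fintype α] {F G : α → ℝ} {a u₀ : ℝ}
    (hF0 : ∀ x, 0 ≤ F x) (hF1 : ∀ x, F x ≤ 1) (hG0 : ∀ x, 0 ≤ G x) (hG1 : ∀ x, G x ≤ 1)
    (ha : 0 ≤ a) (hu0 : 0 ≤ u₀) (hu1 : u₀ ≤ 1)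
    (h : ∀ u, u₀ < u → u ≤ 1 → ((univ.filter fun x => u ≤ F x).card : ℝ) ≤
      a * (univ.filter fun x => u ≤ G x).card + 1) :
    ∑ x, F x ≤ a * ∑ x, G x + 1 + Fintype.card α * u₀ := by
  have hle : ∀ u ∈ Set.Icc (0 : ℝ) 1, ∑ x, (if u ≤ F x then (1 : ℝ) else 0) ≤
      a * ∑ x, (if u ≤ G x then (1 : ℝ) else 0) + 1 +
        Fintype.card α * (if u ≤ u₀ then (1 : ℝ) else 0) := by
    intro u hu
    rw [sum_boole, sum_boole]
    split_ifs with hu'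
    · have h1 : ((univ.filter fun x => u ≤ F x).card : ℝ) ≤ Fintype.card α := by
        exact_mod_cast card_le_univ _
      have h2 : (0 : ℝ) ≤ a * (univ.filter fun x => u ≤ G x).card := by positivity
      linarith
    · simpa using h u (not_le.1 hu') hu.2
  have hFi := fun x => integral_indicator_le (hF0 x) (hF1 x)
  have hGi := fun x => integral_indicator_le (hG0 x) (hG1 x)
  have hui := integral_indicator_le hu0 hu1
  have hFint := IntervalIntegrable.sum univ fun x _ => (hFi x).1
  have hGint := IntervalIntegrable.sum univ fun x _ => (hGi x).1
  simp only [Finset.sum_fn] at hFint hGint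
  have hc : IntervalIntegrable (fun _ : ℝ => (1 : ℝ)) MeasureTheory.volume 0 1 :=
    intervalIntegrable_const
  have key := intervalIntegral.integral_mono_on (zero_le_one' ℝ) hFint
    (((hGint.const_mul a).add hc).add (hui.1.const_mul _)) hle
  rw [intervalIntegral.integral_add ((hGint.const_mul a).add hc) (hui.1.const_mul _),
    intervalIntegral.integral_add (hGint.const_mul a) hc, intervalIntegral.integral_const_mul,
    intervalIntegral.integral_const_mul, hui.2,
    intervalIntegral.integral_finsetSum fun x _ => (hFi x).1,
    intervalIntegral.integral_finsetSum fun x _ => (hGi x).1] at key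
  simp only [(hFi _).2, (hGi _).2] at key
  simpa using key

/-- The sum of the quantities `(1 - cos) / 4` over the steps of the walk. -/
noncomputable def energy (v : ι → ZMod p) (S : Finset ι) (ξ : ZMod p) : ℝ :=
  ∑ j ∈ S, (1 - dcos (ξ * v j)) / 4

lemma energy_zero (v : ι → ZMod p) (S : Finset ι) : energy v S 0 = 0 := by
  simp [energy, dcos_zero]

lemma energy_add_le (v : ι → ZMod p) (S : Finset ι) (ξ η : ZMod p) :
    energy v S (ξ + η) ≤ 2 * energy v S ξ + 2 * energy v S η := by
  unfold energy
  rw [mul_sum, mul_sum, ← sum_add_distrib]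
  refine sum_le_sum fun j _ => ?_
  have h := one_sub_dcos_add_le (ξ * v j) (η * v j)
  rw [add_mul]
  linarith

lemma charFun_le_exp (v : ι → ZMod p) (S : Finset ι) (ξ : ZMod p) :
    charFun v S ξ ≤ Real.exp (-energy v S ξ) := by
  unfold charFun energy
  rw [← sum_neg_distrib, Real.exp_sum]
  refine prod_le_prod (fun _ _ => lazyFactor_nonneg _) fun j _ => ?_
  have h := Real.add_one_le_exp (-((1 - dcos (ξ * v j)) / 4))
  unfold lazyFactor
  linarith

lemma exp_le_charFun (v : ι → ZMod p) (S : Finset ι) (ξ : ZMod p) :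
    Real.exp (-(2 * energy v S ξ)) ≤ charFun v S ξ := by
  unfold charFun energy
  rw [mul_sum, ← sum_neg_distrib, Real.exp_sum]
  refine prod_le_prod (fun _ _ => (Real.exp_pos _).le) fun j _ => ?_
  have h1 := neg_one_le_dcos (ξ * v j)
  have h2 := dcos_le_one (ξ * v j)
  rw [Real.exp_neg]
  refine inv_le_of_inv_le₀ (by linarith [half_le_lazyFactor (ξ * v j)]) ?_
  refine le_trans ?_ (Real.add_one_le_exp _)
  have h3 := half_le_lazyFactor (ξ * v j)
  rw [inv_le_iff_one_le_mul₀ (by linarith)]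
  unfold lazyFactor at *
  nlinarith

lemma sum_energy (hp : p ≠ 2) (v : ι → ZMod p) {S : Finset ι} (hS : ∀ j ∈ S, v j ≠ 0) :
    ∑ ξ, energy v S ξ = p * (S.card / 4) := by
  unfold energy
  rw [sum_comm]
  have : ∀ j ∈ S, ∑ ξ : ZMod p, (1 - dcos (ξ * v j)) / 4 = p / 4 := by
    intro j hj
    rw [← sum_div, sum_sub_distrib, sum_dcos hp, if_neg (hS j hj)]
    simp [ZMod.card]
  rw [sum_congr rfl this, sum_const, nsmul_eq_mul]
  ring

/-- The frequencies of energy at most `t`. -/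
noncomputable def lowEnergy (v : ι → ZMod p) (S : Finset ι) (t : ℝ) : Finset (ZMod p) :=
  univ.filter fun ξ => energy v S ξ ≤ t

open Pointwise in
lemma card_lowEnergy_growth (v : ι → ZMod p) (S : Finset ι) {t : ℝ} (ht : 0 ≤ t) (r : ℕ) :
    lowEnergy v S (4 ^ r * t) = univ ∨
      2 ^ r * ((lowEnergy v S t).card - 1 : ℝ) + 1 ≤ (lowEnergy v S (4 ^ r * t)).card := by
  induction r with
  | zero => right; simp
  | succ r ih =>
    have ht' : 0 ≤ 4 ^ r * t := by positivity
    set B := lowEnergy v S (4 ^ r * t) with hB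
    have hne : B.Nonempty := ⟨0, by simp [hB, lowEnergy, energy_zero, ht']⟩
    have hsub : B + B ⊆ lowEnergy v S (4 ^ (r + 1) * t) := by
      intro ξ hξ
      obtain ⟨a, ha, b, hb, rfl⟩ := mem_add.1 hξ
      simp only [hB, lowEnergy, mem_filter, mem_univ, true_and] at ha hb ⊢
      have := energy_add_le v S a b
      rw [pow_succ]
      linarith
    have hcd := (ZMod.cauchy_davenport (Fact.out : p.Prime) hne hne).trans (card_le_card hsub)
    rcases min_le_iff.1 hcd with h | h
    · left
      rw [← card_eq_iff_eq_univ, ZMod.card]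
      exact le_antisymm (by simpa [ZMod.card] using card_le_univ (lowEnergy v S (4 ^ (r + 1) * t))) h
    · have h2 : (B.card : ℝ) + B.card - 1 ≤ (lowEnergy v S (4 ^ (r + 1) * t)).card := by
        have h3 : B.card + B.card ≤ (lowEnergy v S (4 ^ (r + 1) * t)).card + 1 := by omega
        have h4 : (B.card : ℝ) + B.card ≤ (lowEnergy v S (4 ^ (r + 1) * t)).card + 1 := by
          exact_mod_cast h3
        linarith
      rcases ih with ih | ih
      · left
        have hB' : B = univ := ih
        rw [hB'] at hsub
        refine eq_univ_of_forall fun ξ => hsub ?_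
        exact mem_add.2 ⟨ξ, mem_univ _, 0, mem_univ _, add_zero ξ⟩
      · right
        rw [pow_succ]
        linarith

/-- A Halász-type inequality: repeating a walk `2·4^r` times shrinks its return probability by a
factor of `2^r`, up to small errors. -/
lemma mean_charFun_pow_le (hp : p ≠ 2) (v : ι → ZMod p) {S : Finset ι} (hS : ∀ j ∈ S, v j ≠ 0)
    (r : ℕ) : (∑ ξ, charFun v S ξ ^ (2 * 4 ^ r)) / p ≤
      1 / 2 ^ r * retProb v S + 1 / p + Real.exp (-(S.card / 2)) := by
  have hp0 := natCast_pos (p := p)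
  have h := sum_le_of_card_superlevel_le (F := fun ξ => charFun v S ξ ^ (2 * 4 ^ r))
    (G := charFun v S) (a := 1 / 2 ^ r) (u₀ := Real.exp (-(S.card / 2)))
    (fun ξ => pow_nonneg (charFun_nonneg v S ξ) _)
    (fun ξ => pow_le_one₀ (charFun_nonneg v S ξ) (charFun_le_one v S ξ)) (charFun_nonneg v S)
    (charFun_le_one v S) (by positivity) (Real.exp_pos _).le
    (Real.exp_le_one_iff.2 (by have : (0 : ℝ) ≤ S.card := by positivity
                               linarith)) ?_
  · rw [ZMod.card] at h
    unfold retProb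
    rw [div_le_iff₀ hp0]
    refine h.trans (le_of_eq ?_)
    field_simp
  intro u hu hu1
  have hu0 : 0 < u := (Real.exp_pos _).trans hu
  set L := -Real.log u with hL
  have hL0 : 0 ≤ L := by
    have := Real.log_nonpos hu0.le hu1
    linarith
  have hLS : L < S.card / 2 := by
    have := (Real.lt_log_iff_exp_lt hu0).2 hu
    linarith
  have hk : (0 : ℝ) < 2 * 4 ^ r := by positivity
  have hsub1 : (univ.filter fun ξ => u ≤ charFun v S ξ ^ (2 * 4 ^ r)) ⊆
      lowEnergy v S (L / (2 * 4 ^ r)) := by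
    intro ξ hξ
    simp only [lowEnergy, mem_filter, mem_univ, true_and] at hξ ⊢
    have h1 : u ≤ Real.exp (-(2 * 4 ^ r * energy v S ξ)) := by
      refine hξ.trans ((pow_le_pow_left₀ (charFun_nonneg v S ξ) (charFun_le_exp v S ξ) _).trans ?_)
      rw [← Real.exp_nat_mul]
      push_cast
      rw [mul_neg]
    rw [← Real.log_le_iff_le_exp hu0] at h1
    rw [le_div_iff₀ hk]
    linarith
  have hsub2 : lowEnergy v S (L / 2) ⊆ univ.filter fun ξ => u ≤ charFun v S ξ := by
    intro ξ hξ
    simp only [lowEnergy, mem_filter, mem_univ, true_and] at hξ ⊢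
    refine le_trans ?_ (exp_le_charFun v S ξ)
    rw [← Real.log_le_iff_le_exp hu0]
    linarith
  have h4 : (4 : ℝ) ^ r * (L / (2 * 4 ^ r)) = L / 2 := by field_simp
  have hgrow := card_lowEnergy_growth v S (t := L / (2 * 4 ^ r)) (by positivity) r
  rw [h4] at hgrow
  rcases hgrow with hg | hg
  · exfalso
    have h5 : ∑ ξ, energy v S ξ ≤ ∑ _ξ : ZMod p, L / 2 := by
      refine sum_le_sum fun ξ _ => ?_
      have : ξ ∈ lowEnergy v S (L / 2) := by rw [hg]; exact mem_univ ξ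
      exact (mem_filter.1 this).2
    rw [sum_energy hp v hS, sum_const, card_univ, ZMod.card, nsmul_eq_mul] at h5
    have := le_of_mul_le_mul_left h5 hp0
    linarith
  · have h6 : ((univ.filter fun ξ => u ≤ charFun v S ξ ^ (2 * 4 ^ r)).card : ℝ) ≤
        (lowEnergy v S (L / (2 * 4 ^ r))).card := by exact_mod_cast card_le_card hsub1
    have h7 : ((lowEnergy v S (L / 2)).card : ℝ) ≤
        (univ.filter fun ξ => u ≤ charFun v S ξ).card := by exact_mod_cast card_le_card hsub2
    have h8 : (0 : ℝ) < 2 ^ r := by positivity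
    have h9 : ((lowEnergy v S (L / (2 * 4 ^ r))).card : ℝ) - 1 ≤
        1 / 2 ^ r * (univ.filter fun ξ => u ≤ charFun v S ξ).card := by
      rw [one_div, inv_mul_eq_div, le_div_iff₀ h8]
      linarith
    linarith

/-- If a walk is a union of `2·4^r` walks with non-zero steps, then its return probability is
smaller by a factor of `2^r` than that of one of the pieces, up to small errors. -/
lemma exists_retProb_le_of_charFun_eq_prod (hp : p ≠ 2) (v : ι → ZMod p) (r q : ℕ) {U : Finset ι}
    {S : ℕ → Finset ι} (hS : ∀ l < 2 * 4 ^ r, (∀ j ∈ S l, v j ≠ 0) ∧ q ≤ (S l).card)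
    (hU : ∀ ξ, charFun v U ξ = ∏ l ∈ range (2 * 4 ^ r), charFun v (S l) ξ) :
    ∃ l < 2 * 4 ^ r, retProb v U ≤
      1 / 2 ^ r * retProb v (S l) + 1 / p + Real.exp (-((q : ℝ) / 2)) := by
  set k := 2 * 4 ^ r with hk
  have hk0 : 0 < k := by positivity
  have hk0' : (k : ℝ) ≠ 0 := by positivity
  have hamgm : ∀ ξ, charFun v U ξ ≤ ∑ l ∈ range k, (1 / k : ℝ) * charFun v (S l) ξ ^ k := by
    intro ξ
    have h := Real.geom_mean_le_arith_mean_weighted (range k) (fun _ => (1 / k : ℝ))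
      (fun l => charFun v (S l) ξ ^ k) (fun _ _ => by positivity) (by simp [hk0'])
      (fun l _ => pow_nonneg (charFun_nonneg _ _ _) _)
    rw [hU]
    refine le_trans (le_of_eq (prod_congr rfl fun l _ => ?_)) h
    rw [one_div, Real.pow_rpow_inv_natCast (charFun_nonneg _ _ _) hk0.ne']
  have hmean : retProb v U ≤
      ∑ l ∈ range k, (1 / k : ℝ) * ((∑ ξ, charFun v (S l) ξ ^ k) / p) := by
    unfold retProb
    rw [div_le_iff₀ natCast_pos, sum_mul]
    refine (sum_le_sum fun ξ _ => hamgm ξ).trans (le_of_eq ?_)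
    rw [sum_comm]
    refine sum_congr rfl fun l _ => ?_
    rw [← mul_sum, mul_assoc, div_mul_cancel₀ _ natCast_pos.ne']
  obtain ⟨l, hl, hmax⟩ := exists_max_image (range k)
    (fun l => (∑ ξ, charFun v (S l) ξ ^ k) / p) ⟨0, mem_range.2 hk0⟩
  refine ⟨l, mem_range.1 hl, ?_⟩
  have h1 : retProb v U ≤ (∑ ξ, charFun v (S l) ξ ^ k) / p := by
    refine hmean.trans ((sum_le_sum fun l' hl' =>
      mul_le_mul_of_nonneg_left (hmax l' hl') (by positivity)).trans (le_of_eq ?_))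
    rw [sum_const, card_range, nsmul_eq_mul]
    field_simp
  refine h1.trans ((mean_charFun_pow_le hp v (hS l (mem_range.1 hl)).1 r).trans ?_)
  gcongr
  exact_mod_cast (hS l (mem_range.1 hl)).2

variable [DecidableEq ι]

/-- Iterating a choice of small sets disjoint from those already chosen. -/
lemma exists_disjoint_family (v : ι → ZMod p) (P : Finset ι → Prop) (G : Finset ι → ι → Prop)
    (k D : ℕ) (step : ∀ U : Finset ι, U.card + D ≤ k * D → ∃ S, Disjoint S U ∧ P S ∧
      S.card ≤ D ∧ ∀ i, i ∉ U → i ∉ S → G S i) :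
    ∃ (U : Finset ι) (S : ℕ → Finset ι), U.card ≤ k * D ∧
      (∀ l < k, P (S l) ∧ S l ⊆ U ∧ (S l).card ≤ D ∧ ∀ i, i ∉ U → G (S l) i) ∧
      ∀ ξ, charFun v U ξ = ∏ l ∈ range k, charFun v (S l) ξ := by
  suffices h : ∀ m ≤ k, ∃ (U : Finset ι) (S : ℕ → Finset ι), U.card ≤ m * D ∧
      (∀ l < m, P (S l) ∧ S l ⊆ U ∧ (S l).card ≤ D ∧ ∀ i, i ∉ U → G (S l) i) ∧
      ∀ ξ, charFun v U ξ = ∏ l ∈ range m, charFun v (S l) ξ from h k le_rfl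
  intro m
  induction m with
  | zero => exact fun _ => ⟨∅, fun _ => ∅, by simp, by simp, by simp [charFun]⟩
  | succ m ih =>
    intro hm
    obtain ⟨U, S, hUc, hS, hprod⟩ := ih (by omega)
    obtain ⟨S', hdisj, hP, hc, hG⟩ := step U (by
      have := Nat.mul_le_mul_right D hm
      rw [Nat.succ_mul] at this
      omega)
    refine ⟨S' ∪ U, fun l => if l = m then S' else S l, ?_, fun l hl => ?_, fun ξ => ?_⟩
    · rw [Nat.succ_mul]
      have := card_union_le S' U
      omega
    · by_cases hlm : l = m
      · simp only [hlm, if_true]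
        refine ⟨hP, subset_union_left, hc, fun i hi => ?_⟩
        rw [mem_union, not_or] at hi
        exact hG i hi.2 hi.1
      · simp only [hlm, if_false]
        obtain ⟨h1, h2, h3, h4⟩ := hS l (by omega)
        refine ⟨h1, h2.trans subset_union_right, h3, fun i hi => ?_⟩
        rw [mem_union, not_or] at hi
        exact h4 i hi.2
    · simp only [prod_range_succ, if_true]
      have h1 : ∏ l ∈ range m, charFun v (if l = m then S' else S l) ξ = charFun v U ξ := by
        rw [hprod]
        refine prod_congr rfl fun l hl => ?_
        rw [if_neg (mem_range.1 hl).ne]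
      rw [h1]
      unfold charFun
      rw [prod_union hdisj, mul_comm]

variable [Fintype ι]

/-- The set of indices of the non-zero coordinates. -/
def suppSet (v : ι → ZMod p) : Finset ι := univ.filter fun i => v i ≠ 0

/-- Outside any `U` one can choose few coordinates, all non-zero, whose neighbourhood contains all
the other coordinates outside `U`. -/
lemma exists_dominating (v : ι → ZMod p) (U : Finset ι) {q D : ℕ}
    (hq : q ≤ (suppSet v \ U).card) (hD : q + 8 * Real.log p ≤ D) :
    ∃ S : Finset ι, Disjoint S U ∧ ((∀ j ∈ S, v j ≠ 0) ∧ q ≤ S.card) ∧ S.card ≤ D ∧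
      ∀ i, i ∉ U → i ∉ S → v i ∈ nbhd v S := by
  obtain ⟨S₀, hS₀, hS₀q⟩ := exists_subset_card_eq hq
  set 𝒞 := (suppSet v \ U).powerset.filter fun S => q ≤ S.card with h𝒞
  have hmem : S₀ ∈ 𝒞 := by simp [h𝒞, hS₀, hS₀q]
  obtain ⟨S, hS, hmin⟩ := exists_min_image 𝒞 (fun S => retProb v S * (8 / 7) ^ S.card) ⟨S₀, hmem⟩
  obtain ⟨hSsub, hSq⟩ : S ⊆ suppSet v \ U ∧ q ≤ S.card := by simpa [h𝒞] using hS
  refine ⟨S, ?_, ⟨fun j hj => ?_, hSq⟩, ?_, fun i hiU hiS => ?_⟩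
  · exact disjoint_of_subset_left hSsub sdiff_disjoint
  · have := hSsub hj
    simp [suppSet] at this
    exact this.1
  · have h1 := hmin S₀ hmem
    rw [hS₀q] at h1
    have h2 : 1 / (p : ℝ) * (8 / 7) ^ S.card ≤ (8 / 7) ^ q :=
      (mul_le_mul_of_nonneg_right (one_div_le_retProb v S) (by positivity)).trans
        (h1.trans (mul_le_of_le_one_left (by positivity) (retProb_le_one v S₀)))
    obtain ⟨m, hm⟩ := Nat.exists_eq_add_of_le hSq
    have hp0 := natCast_pos (p := p)
    rw [hm, pow_add, one_div, inv_mul_le_iff₀ hp0, mul_comm (p : ℝ)] at h2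
    have h3 : (8 / 7 : ℝ) ^ m ≤ p := le_of_mul_le_mul_left h2 (by positivity)
    have h4 := Real.log_le_log (by positivity) h3
    rw [Real.log_pow] at h4
    have h5 := Real.one_sub_inv_le_log_of_pos (x := 8 / 7) (by norm_num)
    have h6 : (m : ℝ) * (1 / 8) ≤ m * Real.log (8 / 7) := by
      gcongr
      norm_num at h5
      linarith
    have h7 : (S.card : ℝ) ≤ D := by
      rw [hm]
      push_cast
      linarith
    exact_mod_cast h7
  · by_cases hv : v i = 0
    · rw [hv]
      exact zero_mem_nbhd v S
    have h1 : insert i S ∈ 𝒞 := by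
      simp only [h𝒞, mem_filter, mem_powerset, card_insert_of_notMem hiS]
      refine ⟨insert_subset ?_ hSsub, by omega⟩
      simp [suppSet, hv, hiU]
    have h2 := hmin _ h1
    rw [card_insert_of_notMem hiS, pow_succ, retProb_insert v hiS] at h2
    simp only [nbhd, mem_filter, mem_univ, true_and]
    have h3 : (0 : ℝ) < (8 / 7) ^ S.card := by positivity
    have h4 : retProb v S ≤ (3 / 4 * retProb v S + 1 / 4 * lazyProb v S (v i)) * (8 / 7) := by
      refine le_of_mul_le_mul_right (h2.trans (le_of_eq ?_)) h3
      ring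
    linarith

/-- The rough structure of a vector: all coordinates outside `T` lie in the neighbourhood
of the small subvector on `T₂`, those in `T` outside `T₁` lie in the neighbourhood of the small
subvector on `T₁`, and the walk on `T` is much more spread out than the walk on `T₂`. -/
structure Captured (v : ι → ZMod p) (η : ℝ) (D K : ℕ) (T T₁ T₂ : Finset ι) : Prop where
  subset : T₁ ⊆ T
  card_le : T.card ≤ K
  card_le₁ : T₁.card ≤ D
  card_le₂ : T₂.card ≤ D
  mem_nbhd₁ : ∀ i ∈ T, i ∉ T₁ → v i ∈ nbhd v T₁
  mem_nbhd₂ : ∀ i, i ∉ T → v i ∈ nbhd v T₂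
  retProb_le : retProb v T ≤ η * retProb v T₂

/-- A rough inverse Littlewood–Offord theorem. -/
lemma exists_captured (hp : p ≠ 2) (v : ι → ZMod p) {r q D : ℕ} (hq : 2 * Real.log p ≤ q)
    (hD : q + 8 * Real.log p ≤ D) (hsupp : 2 * 4 ^ r * (2 * r) ≤ (suppSet v).card)
    (hpr : (2 : ℝ) ^ r ≤ p) (hret : 4 / (p : ℝ) ≤ retProb v univ) :
    ∃ T T₁ T₂ : Finset ι, Captured v (4 / 2 ^ r) D ((2 * 4 ^ r + 1) * D) T T₁ T₂ := by
  have hp0 := natCast_pos (p := p)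
  have hlog : 0 ≤ Real.log p :=
    Real.log_nonneg (by exact_mod_cast (Fact.out : p.Prime).one_le)
  have hqD : q ≤ D := by
    have : (q : ℝ) ≤ D := by linarith
    exact_mod_cast this
  have h2r : (0 : ℝ) < 2 ^ r := by positivity
  by_cases hcase : (2 * 4 ^ r + 1) * D ≤ (suppSet v).card
  · rw [Nat.succ_mul] at hcase
    have hstep : ∀ U : Finset ι, U.card + D ≤ 2 * 4 ^ r * D →
        ∃ S : Finset ι, Disjoint S U ∧ ((∀ j ∈ S, v j ≠ 0) ∧ q ≤ S.card) ∧ S.card ≤ D ∧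
          ∀ i, i ∉ U → i ∉ S → v i ∈ nbhd v S := by
      intro U hU
      refine exists_dominating v U ?_ hD
      have := le_card_sdiff U (suppSet v)
      omega
    obtain ⟨U, S, hUc, hS, hprod⟩ := exists_disjoint_family v
      (fun S => (∀ j ∈ S, v j ≠ 0) ∧ q ≤ S.card) (fun S i => v i ∈ nbhd v S) (2 * 4 ^ r) D hstep
    obtain ⟨l, hl, hle⟩ := exists_retProb_le_of_charFun_eq_prod hp v r q
      (fun l hl => (hS l hl).1) hprod
    obtain ⟨T₁, -, -, hT₁c, hT₁⟩ := exists_dominating v ∅ (q := q) (D := D)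
      (by rw [sdiff_empty]; omega) hD
    obtain ⟨-, -, hlc, hlmem⟩ := hS l hl
    refine ⟨U ∪ T₁, T₁, S l, subset_union_right, ?_, hT₁c, hlc, fun i _ hi => ?_, fun i hi => ?_, ?_⟩
    · rw [Nat.succ_mul]
      have := card_union_le U T₁
      omega
    · exact hT₁ i (notMem_empty i) hi
    · rw [mem_union, not_or] at hi
      exact hlmem i hi.1
    · refine (retProb_anti v subset_union_left).trans ?_
      have hexp : Real.exp (-((q : ℝ) / 2)) ≤ 1 / p := by
        rw [one_div, ← Real.exp_log hp0, ← Real.exp_neg]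
        exact Real.exp_le_exp.2 (by linarith)
      have hU : 4 / (p : ℝ) ≤ retProb v U := hret.trans (retProb_anti v (subset_univ U))
      have h4 : 4 / (p : ℝ) = 4 * (1 / p) := by ring
      have h5 : 4 / 2 ^ r * retProb v (S l) = 4 * (1 / 2 ^ r * retProb v (S l)) := by ring
      have h6 : 0 ≤ 1 / 2 ^ r * retProb v (S l) :=
        mul_nonneg (by positivity) (retProb_pos _ _).le
      rw [h5]
      linarith
  · have hstep : ∀ U : Finset ι, U.card + 2 * r ≤ 2 * 4 ^ r * (2 * r) →
        ∃ S : Finset ι, Disjoint S U ∧ ((∀ j ∈ S, v j ≠ 0) ∧ S ⊆ suppSet v ∧ 2 * r ≤ S.card) ∧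
          S.card ≤ 2 * r ∧ ∀ i, i ∉ U → i ∉ S → True := by
      intro U hU
      obtain ⟨S, hSs, hSc⟩ := exists_subset_card_eq (s := suppSet v \ U) (n := 2 * r) (by
        have := le_card_sdiff U (suppSet v)
        omega)
      refine ⟨S, disjoint_of_subset_left hSs sdiff_disjoint, ⟨fun j hj => ?_,
        hSs.trans sdiff_subset, hSc.ge⟩, hSc.le, fun _ _ _ => trivial⟩
      have := hSs hj
      simp [suppSet] at this
      exact this.1
    obtain ⟨U, S, -, hS, hprod⟩ := exists_disjoint_family v
      (fun S => (∀ j ∈ S, v j ≠ 0) ∧ S ⊆ suppSet v ∧ 2 * r ≤ S.card) (fun _ _ => True)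
      (2 * 4 ^ r) (2 * r) hstep
    obtain ⟨l, hl, hle⟩ := exists_retProb_le_of_charFun_eq_prod hp v r (2 * r)
      (fun l hl => ⟨(hS l hl).1.1, (hS l hl).1.2.2⟩) hprod
    have hT₁ : ∃ T₁ ⊆ suppSet v, T₁.card ≤ D ∧ ∀ i ∈ suppSet v, i ∉ T₁ → v i ∈ nbhd v T₁ := by
      obtain ⟨T₁, -, ⟨hT₁s, -⟩, hT₁c, hT₁⟩ := exists_dominating v ∅ (q := 0) (D := D)
        (Nat.zero_le _) (by push_cast; linarith [(Nat.cast_nonneg q : (0 : ℝ) ≤ q)])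
      exact ⟨T₁, fun j hj => by simpa [suppSet] using hT₁s j hj, hT₁c,
        fun i _ hi => hT₁ i (notMem_empty i) hi⟩
    obtain ⟨T₁, hT₁s, hT₁c, hT₁⟩ := hT₁
    have hUret : retProb v (suppSet v) ≤ retProb v U := by
      unfold retProb
      gcongr with ξ
      have h1 : charFun v (suppSet v) ξ = charFun v univ ξ := by
        unfold charFun
        refine prod_subset (subset_univ _) fun j _ hj => ?_
        have : v j = 0 := by simpa [suppSet] using hj
        rw [this, mul_zero, lazyFactor_zero]
      rw [h1]
      exact charFun_anti v (subset_univ U) ξ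
    refine ⟨suppSet v, T₁, ∅, hT₁s, by omega, hT₁c, by simp, hT₁, fun i hi => ?_, ?_⟩
    · have : v i = 0 := by simpa [suppSet] using hi
      rw [this]
      exact zero_mem_nbhd v ∅
    · rw [retProb_empty, mul_one]
      refine hUret.trans (hle.trans ?_)
      have h1 : 1 / (p : ℝ) ≤ 1 / 2 ^ r := one_div_le_one_div_of_le h2r hpr
      have h2 : Real.exp (-(((2 * r : ℕ) : ℝ) / 2)) ≤ 1 / 2 ^ r := by
        rw [one_div, Real.exp_neg]
        refine inv_anti₀ h2r ?_
        have h3 : (2 : ℝ) ≤ Real.exp 1 := by linarith [Real.add_one_le_exp 1]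
        refine (pow_le_pow_left₀ (by norm_num) h3 r).trans (le_of_eq ?_)
        rw [← Real.exp_nat_mul]
        congr 1
        push_cast
        ring
      have h3 : 1 / 2 ^ r * retProb v (S l) ≤ 1 / 2 ^ r :=
        mul_le_of_le_one_right (by positivity) (retProb_le_one _ _)
      have h4 : (4 : ℝ) / 2 ^ r = 4 * (1 / 2 ^ r) := by ring
      have h5 : (0 : ℝ) < 1 / 2 ^ r := by positivity
      rw [h4]
      linarith

section Counting

variable {n : ℕ}

/-- The largest atom of `M_n v`. -/
noncomputable def maxProb (v : Fin n → ZMod p) : ℝ :=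
  ⨆ w : Fin n → ZMod p, symPr n {A | (A.map (Int.cast : ℤ → ZMod p)).mulVec v = w}

lemma maxProb_le (v : Fin n → ZMod p) (r : Fin n → ℕ) :
    maxProb v ≤ ∏ i, retProb v (univ.filter fun j => r i < r j) :=
  ciSup_le fun w => symPr_mulVec_le v w r

/-- The factor contributed by the `i`-th row, given the sets capturing `v`. -/
noncomputable def rowBound (v : Fin n → ZMod p) (T T₁ T₂ : Finset (Fin n)) (i : Fin n) : ℝ :=
  if i ∈ T₁ ∪ T₂ then 1 else retProb v (if i ∈ T then T₁ else T₂)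

lemma rowBound_nonneg (v : Fin n → ZMod p) (T T₁ T₂ : Finset (Fin n)) (i : Fin n) :
    0 ≤ rowBound v T T₁ T₂ i := by
  unfold rowBound
  split_ifs
  exacts [zero_le_one, (retProb_pos _ _).le, (retProb_pos _ _).le]

lemma Captured.maxProb_le {v : Fin n → ZMod p} {η : ℝ} {D K : ℕ} {T T₁ T₂ : Finset (Fin n)}
    (h : Captured v η D K T T₁ T₂) (h0 : 0 ≤ η) (h1 : η ≤ 1) :
    maxProb v ≤ η ^ (n - K) * ∏ i, rowBound v T T₁ T₂ i := by
  refine (LazyWalk.maxProb_le v fun i => if i ∈ T₁ then 2 else if i ∈ T then 1 else 0).trans ?_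
  have hrow : ∀ i, retProb v (univ.filter fun j =>
      (if i ∈ T₁ then 2 else if i ∈ T then 1 else 0) <
        (if j ∈ T₁ then 2 else if j ∈ T then 1 else 0)) ≤
      (if i ∈ T then 1 else η) * rowBound v T T₁ T₂ i := by
    intro i
    unfold rowBound
    by_cases hT : i ∈ T
    · simp only [hT, if_true, one_mul]
      by_cases hi : i ∈ T₁ ∪ T₂
      · rw [if_pos hi]
        exact retProb_le_one _ _
      · rw [if_neg hi]
        refine retProb_anti v fun j hj => ?_
        rw [mem_union, not_or] at hi
        simp [hi.1, hj]
    · have hT₁ : i ∉ T₁ := fun hi => hT (h.subset hi)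
      simp only [hT, hT₁, if_false]
      refine (retProb_anti v (S := T) fun j hj => ?_).trans
        (h.retProb_le.trans (mul_le_mul_of_nonneg_left ?_ h0))
      · simp only [mem_filter, mem_univ, true_and, hj, if_true]
        split_ifs <;> norm_num
      · split_ifs
        exacts [retProb_le_one _ _, le_rfl]
  refine (prod_le_prod (fun i _ => (retProb_pos _ _).le) fun i _ => hrow i).trans ?_
  rw [prod_mul_distrib]
  refine mul_le_mul_of_nonneg_right ?_ (prod_nonneg fun i _ => rowBound_nonneg _ _ _ _ i)
  rw [prod_ite, prod_const_one, one_mul, prod_const, filter_not, filter_mem_eq_inter, univ_inter,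
    card_sdiff_of_subset (subset_univ T), card_univ, Fintype.card_fin]
  exact pow_le_pow_of_le_one h0 h1 (Nat.sub_le_sub_left h.card_le n)

lemma sum_rowBound_le (hp : p ≠ 2) {η : ℝ} {D K : ℕ} {T T₁ T₂ : Finset (Fin n)}
    (V : Finset (Fin n → ZMod p)) (hV : ∀ v ∈ V, Captured v η D K T T₁ T₂) :
    ∑ v ∈ V, ∏ i, rowBound v T T₁ T₂ i ≤ (p : ℝ) ^ (2 * D) * 2 ^ n := by
  obtain rfl | ⟨v₀, hv₀⟩ := V.eq_empty_or_nonempty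
  · simp only [sum_empty]
    positivity
  have hB : (T₁ ∪ T₂).card ≤ 2 * D := by
    have := card_union_le T₁ T₂
    have := (hV v₀ hv₀).card_le₁
    have := (hV v₀ hv₀).card_le₂
    omega
  set proj : (Fin n → ZMod p) → Fin n → ZMod p := fun v i => if i ∈ T₁ ∪ T₂ then v i else 0
    with hproj
  set U : Finset (Fin n → ZMod p) :=
    Fintype.piFinset fun i => if i ∈ T₁ ∪ T₂ then univ else {0} with hU
  have hUcard : (U.card : ℝ) ≤ (p : ℝ) ^ (2 * D) := by
    have h1 : U.card = p ^ (T₁ ∪ T₂).card := by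
      rw [hU, Fintype.card_piFinset]
      simp_rw [apply_ite Finset.card]
      rw [prod_ite, prod_const, card_univ, ZMod.card, filter_mem_eq_inter, univ_inter]
      simp
    rw [h1]
    push_cast
    exact pow_le_pow_right₀ (by exact_mod_cast (Fact.out : p.Prime).one_le) hB
  have hmaps : ∀ v ∈ V, proj v ∈ U := by
    intro v _
    rw [hU, Fintype.mem_piFinset]
    intro i
    simp only [hproj]
    split_ifs <;> simp
  rw [← sum_fiberwise_of_maps_to hmaps]
  have hfib : ∀ u ∈ U, ∑ v ∈ V with proj v = u, ∏ i, rowBound v T T₁ T₂ i ≤ 2 ^ n := by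
    intro u _
    have hagree : ∀ v, proj v = u → ∀ i ∈ T₁ ∪ T₂, v i = u i := by
      rintro v rfl i hi
      simp [hproj, mem_union.1 hi]
    have hagree' : ∀ v, proj v = u → ∀ i, ∀ j ∈ (if i ∈ T then T₁ else T₂), v j = u j := by
      intro v hv i j hj
      refine hagree v hv j ?_
      split_ifs at hj
      exacts [mem_union_left _ hj, mem_union_right _ hj]
    set A : Fin n → Finset (ZMod p) := fun i =>
      if i ∈ T₁ ∪ T₂ then {u i} else nbhd u (if i ∈ T then T₁ else T₂) with hA
    have hsub : (V.filter fun v => proj v = u) ⊆ Fintype.piFinset A := by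
      intro v hv
      obtain ⟨hvV, hvu⟩ := mem_filter.1 hv
      rw [Fintype.mem_piFinset]
      intro i
      simp only [hA]
      split_ifs with hi hT
      · simp [hagree v hvu i hi]
      · have := nbhd_congr (hagree' v hvu i)
        rw [if_pos hT] at this
        rw [← this]
        rw [mem_union, not_or] at hi
        exact (hV v hvV).mem_nbhd₁ i hT hi.1
      · have := nbhd_congr (hagree' v hvu i)
        rw [if_neg hT] at this
        rw [← this]
        exact (hV v hvV).mem_nbhd₂ i hT
    have hterm : ∀ v ∈ V.filter (fun v => proj v = u),
        ∏ i, rowBound v T T₁ T₂ i = ∏ i, rowBound u T T₁ T₂ i := by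
      intro v hv
      refine prod_congr rfl fun i _ => ?_
      unfold rowBound
      rw [retProb_congr (hagree' v (mem_filter.1 hv).2 i)]
    rw [sum_congr rfl hterm, sum_const, nsmul_eq_mul]
    have h0 : 0 ≤ ∏ i, rowBound u T T₁ T₂ i := prod_nonneg fun i _ => rowBound_nonneg _ _ _ _ i
    have h1 : ((V.filter fun v => proj v = u).card : ℝ) ≤ ∏ i, ((A i).card : ℝ) := by
      have := card_le_card hsub
      rw [Fintype.card_piFinset] at this
      exact_mod_cast this
    refine (mul_le_mul_of_nonneg_right h1 h0).trans ?_
    rw [← prod_mul_distrib]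
    have h2 : ∏ _i : Fin n, (2 : ℝ) = 2 ^ n := by simp
    rw [← h2]
    refine prod_le_prod (fun i _ => mul_nonneg (Nat.cast_nonneg _) (rowBound_nonneg _ _ _ _ i))
      fun i _ => ?_
    simp only [hA, rowBound]
    split_ifs
    · norm_num
    all_goals exact card_nbhd_mul_retProb_le hp _ _
  refine (sum_le_sum hfib).trans ?_
  rw [sum_const, nsmul_eq_mul]
  gcongr

/-- The contribution of the vectors with rough structure. -/
lemma sum_maxProb_captured_le (hp : p ≠ 2) {η : ℝ} (h0 : 0 ≤ η) (h1 : η ≤ 1) {D K : ℕ}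
    (V : Finset (Fin n → ZMod p)) (hV : ∀ v ∈ V, ∃ T T₁ T₂, Captured v η D K T T₁ T₂) :
    ∑ v ∈ V, maxProb v ≤ 16 ^ n * (p : ℝ) ^ (2 * D) * η ^ (n - K) := by
  classical
  choose! T T₁ T₂ hT using hV
  have hmaps : ∀ v ∈ V, (T v, T₁ v, T₂ v) ∈
      (univ : Finset (Finset (Fin n) × Finset (Fin n) × Finset (Fin n))) := fun _ _ => mem_univ _
  rw [← sum_fiberwise_of_maps_to hmaps]
  have hfib : ∀ t ∈ (univ : Finset (Finset (Fin n) × Finset (Fin n) × Finset (Fin n))),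
      ∑ v ∈ V with (T v, T₁ v, T₂ v) = t, maxProb v ≤
        η ^ (n - K) * ((p : ℝ) ^ (2 * D) * 2 ^ n) := by
    rintro ⟨t, t₁, t₂⟩ -
    have hcap : ∀ v ∈ V.filter (fun v => (T v, T₁ v, T₂ v) = (t, t₁, t₂)),
        Captured v η D K t t₁ t₂ := by
      intro v hv
      obtain ⟨hvV, hvt⟩ := mem_filter.1 hv
      simp only [Prod.mk.injEq] at hvt
      obtain ⟨rfl, rfl, rfl⟩ := hvt
      exact hT v hvV
    refine (sum_le_sum fun v hv => (hcap v hv).maxProb_le h0 h1).trans ?_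
    rw [← mul_sum]
    exact mul_le_mul_of_nonneg_left (sum_rowBound_le hp _ hcap) (pow_nonneg h0 _)
  refine (sum_le_sum hfib).trans (le_of_eq ?_)
  rw [sum_const, nsmul_eq_mul, card_univ]
  simp only [Fintype.card_prod, Fintype.card_finset, Fintype.card_fin]
  have h16 : (16 : ℝ) ^ n = 2 ^ n * (2 ^ n * 2 ^ n) * 2 ^ n := by
    rw [← mul_pow, ← mul_pow, ← mul_pow]
    norm_num
  rw [h16]
  push_cast
  ring

lemma maxProb_le_of_ne_zero (hp : p ≠ 2) {v : Fin n → ZMod p} (hv : v ≠ 0) :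
    maxProb v ≤ (3 / 4) ^ (n - (suppSet v).card) := by
  obtain ⟨a, ha⟩ := Function.ne_iff.1 hv
  refine (maxProb_le v fun i => if i ∈ suppSet v then 1 else 0).trans ?_
  have hrow : ∀ i, retProb v (univ.filter fun j =>
      (if i ∈ suppSet v then 1 else 0) < (if j ∈ suppSet v then 1 else 0)) ≤
      if i ∈ suppSet v then 1 else 3 / 4 := by
    intro i
    split_ifs with hi
    · exact retProb_le_one _ _
    · refine retProb_le_of_ne_zero hp v (i := a) ?_ ha
      have : v a ≠ 0 := ha
      simp [suppSet, this]
  refine (prod_le_prod (fun i _ => (retProb_pos _ _).le) fun i _ => hrow i).trans (le_of_eq ?_)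
  rw [prod_ite, prod_const_one, one_mul, prod_const, filter_not, filter_mem_eq_inter, univ_inter,
    card_sdiff_of_subset (subset_univ _), card_univ, Fintype.card_fin]

lemma card_suppSet_le_le (hn : 0 < n) (s : ℕ) :
    (univ.filter fun v : Fin n → ZMod p => (suppSet v).card ≤ s).card ≤ (n * p) ^ s := by
  induction s with
  | zero =>
    rw [pow_zero, card_le_one]
    have : ∀ v : Fin n → ZMod p, (suppSet v).card ≤ 0 → v = 0 := by
      intro v hv
      rw [Nat.le_zero, card_eq_zero] at hv
      funext i
      by_contra hi
      have : i ∈ suppSet v := by simpa [suppSet] using hi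
      simp [hv] at this
    intro v hv u hu
    rw [this v (mem_filter.1 hv).2, this u (mem_filter.1 hu).2]
  | succ s ih =>
    have hsub : (univ.filter fun v : Fin n → ZMod p => (suppSet v).card ≤ s + 1) ⊆
        ((univ.filter fun v : Fin n → ZMod p => (suppSet v).card ≤ s) ×ˢ
          (univ : Finset (Fin n × ZMod p))).image fun x => Function.update x.1 x.2.1 x.2.2 := by
      intro v hv
      rw [mem_image]
      have hvs := (mem_filter.1 hv).2
      by_cases hemp : (suppSet v).Nonempty
      · obtain ⟨i, hi⟩ := hemp
        refine ⟨(Function.update v i 0, i, v i), ?_, by simp⟩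
        simp only [mem_product, mem_filter, mem_univ, and_true, true_and]
        have : suppSet (Function.update v i 0) ⊆ (suppSet v).erase i := by
          intro j hj
          simp only [suppSet, mem_filter, mem_univ, true_and, mem_erase] at hj ⊢
          by_cases hji : j = i
          · simp [hji] at hj
          · simpa [hji] using hj
        have h1 := card_le_card this
        rw [card_erase_of_mem hi] at h1
        omega
      · rw [not_nonempty_iff_eq_empty] at hemp
        refine ⟨(v, ⟨0, hn⟩, v ⟨0, hn⟩), ?_, by simp⟩
        simp [hemp]
    refine (card_le_card hsub).trans (card_image_le.trans ?_)
    rw [card_product, card_univ, Fintype.card_prod, Fintype.card_fin, ZMod.card, pow_succ]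
    gcongr

/-- The contribution of the non-zero vectors with tiny support. -/
lemma sum_maxProb_sparse_le (hp : p ≠ 2) (hn : 0 < n) {s : ℕ} (V : Finset (Fin n → ZMod p))
    (hV : ∀ v ∈ V, v ≠ 0 ∧ (suppSet v).card ≤ s) :
    ∑ v ∈ V, maxProb v ≤ ((n : ℝ) * p) ^ s * (3 / 4) ^ (n - s) := by
  have h1 : ∀ v ∈ V, maxProb v ≤ (3 / 4) ^ (n - s) := fun v hv =>
    (maxProb_le_of_ne_zero hp (hV v hv).1).trans
      (pow_le_pow_of_le_one (by norm_num) (by norm_num) (Nat.sub_le_sub_left (hV v hv).2 n))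
  refine (sum_le_sum h1).trans ?_
  rw [sum_const, nsmul_eq_mul]
  gcongr
  have h2 : V ⊆ univ.filter fun v : Fin n → ZMod p => (suppSet v).card ≤ s :=
    fun v hv => by simp [(hV v hv).2]
  exact_mod_cast (card_le_card h2).trans (card_suppSet_le_le hn s)

/-- The combined bound for the vectors whose walk is not too spread out. -/
lemma sum_maxProb_le (hp : p ≠ 2) (hn : 0 < n) {r q D : ℕ} (hq : 2 * Real.log p ≤ q)
    (hD : q + 8 * Real.log p ≤ D) (hpr : (2 : ℝ) ^ r ≤ p) (hr : 2 ≤ r)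
    (V : Finset (Fin n → ZMod p)) (hV : ∀ v ∈ V, v ≠ 0 ∧ 4 / (p : ℝ) ≤ retProb v univ) :
    ∑ v ∈ V, maxProb v ≤
      16 ^ n * (p : ℝ) ^ (2 * D) * (4 / 2 ^ r) ^ (n - (2 * 4 ^ r + 1) * D) +
        ((n : ℝ) * p) ^ (2 * 4 ^ r * (2 * r)) * (3 / 4) ^ (n - 2 * 4 ^ r * (2 * r)) := by
  rw [← sum_filter_add_sum_filter_not V fun v => 2 * 4 ^ r * (2 * r) ≤ (suppSet v).card]
  refine add_le_add (sum_maxProb_captured_le hp (by positivity) ?_ _ fun v hv => ?_)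
    (sum_maxProb_sparse_le hp hn _ fun v hv => ?_)
  · rw [div_le_one (by positivity)]
    calc (4 : ℝ) = 2 ^ 2 := by norm_num
      _ ≤ 2 ^ r := pow_le_pow_right₀ (by norm_num) hr
  · obtain ⟨hvV, hvs⟩ := mem_filter.1 hv
    exact exists_captured hp v hq hD hvs hpr (hV v hvV).2
  · obtain ⟨hvV, hvs⟩ := mem_filter.1 hv
    exact ⟨(hV v hvV).1, (not_le.1 hvs).le⟩

end Counting

section Asymptotics

lemma captured_term_le {n r D : ℕ} {x : ℝ} (hx : 1 ≤ Real.log x) (hx0 : 0 < x)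
    (hn : 100 ≤ Real.log n) (hxn : Real.log x ^ 2 ≤ n * Real.log n / 640000)
    (hD : (D : ℝ) ≤ 12 * Real.log x) (hr : (2 : ℝ) ^ (8 * r) ≤ n)
    (hr' : (n : ℝ) ≤ 2 ^ (8 * r + 8)) :
    16 ^ n * x ^ (2 * D) * (4 / 2 ^ r) ^ (n - (2 * 4 ^ r + 1) * D) ≤ Real.exp (-n) := by
  have hn0 : (0 : ℝ) < n := lt_of_lt_of_le (by positivity) hr
  have hy1 : (1 : ℝ) ≤ 2 ^ r := one_le_pow₀ (by norm_num)
  have h4 : (4 : ℝ) ^ r = (2 ^ r) ^ 2 := by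
    rw [← pow_mul, mul_comm, pow_mul]
    norm_num
  have hlog2 := Real.log_two_lt_d9
  have hlog2' := Real.log_two_gt_d9
  have hlog4 : Real.log 4 = 2 * Real.log 2 := by
    rw [show (4 : ℝ) = 2 ^ 2 by norm_num, Real.log_pow]
    norm_num
  have hlog16 : Real.log 16 = 4 * Real.log 2 := by
    rw [show (16 : ℝ) = 2 ^ 4 by norm_num, Real.log_pow]
    norm_num
  have hlogr : Real.log n ≤ (8 * r + 8) * Real.log 2 := by
    have := Real.log_le_log hn0 hr'
    rw [Real.log_pow] at this
    exact_mod_cast this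
  set t := Real.sqrt n with ht
  have htn : t ^ 2 = n := Real.sq_sqrt hn0.le
  have ht0 : 0 < t := Real.sqrt_pos.2 hn0
  have hLt : Real.log n ≤ 2 * t := by
    rw [← htn, Real.log_pow]
    have := Real.log_le_sub_one_of_pos ht0
    push_cast
    linarith
  have hyt : ((2 : ℝ) ^ r) ^ 4 ≤ t := by
    refine le_of_sq_le_sq ?_ ht0.le
    rw [htn, ← pow_mul, ← pow_mul]
    refine le_trans (le_of_eq ?_) hr
    congr 1
    ring
  have hK : 2 * (((2 * 4 ^ r + 1) * D : ℕ) : ℝ) ≤ n := by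
    push_cast
    rw [h4]
    have h1 : 2 * ((2 * ((2 : ℝ) ^ r) ^ 2 + 1) * D) ≤ 72 * ((2 ^ r) ^ 2 * Real.log x) := by
      have h2 : 2 * ((2 : ℝ) ^ r) ^ 2 + 1 ≤ 3 * (2 ^ r) ^ 2 := by nlinarith
      calc 2 * ((2 * ((2 : ℝ) ^ r) ^ 2 + 1) * D)
          ≤ 2 * ((3 * (2 ^ r) ^ 2) * (12 * Real.log x)) := by gcongr
        _ = _ := by ring
    refine h1.trans (le_of_sq_le_sq ?_ hn0.le)
    calc (72 * (((2 : ℝ) ^ r) ^ 2 * Real.log x)) ^ 2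
        = 5184 * (((2 ^ r) ^ 4) * Real.log x ^ 2) := by ring
      _ ≤ 5184 * (t * (n * (2 * t) / 640000)) := by
          gcongr
          exact hxn.trans (by gcongr)
      _ = 10368 / 640000 * (t ^ 2 * n) := by ring
      _ ≤ n ^ 2 := by
          rw [htn]
          nlinarith
  have hKn : (2 * 4 ^ r + 1) * D ≤ n := by
    have : (((2 * 4 ^ r + 1) * D : ℕ) : ℝ) ≤ n := by
      linarith [(Nat.cast_nonneg ((2 * 4 ^ r + 1) * D) : (0 : ℝ) ≤ _)]
    exact_mod_cast this
  rw [← Real.log_le_iff_le_exp (by positivity), Real.log_mul (by positivity) (by positivity),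
    Real.log_mul (by positivity) (by positivity), Real.log_pow, Real.log_pow, Real.log_pow,
    Real.log_div (by norm_num) (by positivity), Real.log_pow, Nat.cast_sub hKn, hlog4, hlog16]
  set K := (((2 * 4 ^ r + 1) * D : ℕ) : ℝ)
  have h1 : ((2 * D : ℕ) : ℝ) * Real.log x ≤ n * Real.log n / 26000 := by
    push_cast
    have : 2 * (D : ℝ) * Real.log x ≤ 2 * (12 * Real.log x) * Real.log x := by gcongr
    nlinarith
  have h2 : ((n : ℝ) - K) * (2 * Real.log 2 - r * Real.log 2) ≤
      n / 2 * (3 * Real.log 2 - Real.log n / 8) := by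
    have h3 : 2 * Real.log 2 - r * Real.log 2 ≤ 3 * Real.log 2 - Real.log n / 8 := by linarith
    have h4 : 3 * Real.log 2 - Real.log n / 8 ≤ 0 := by linarith
    have h5 : (n : ℝ) / 2 ≤ n - K := by linarith
    calc _ ≤ ((n : ℝ) - K) * (3 * Real.log 2 - Real.log n / 8) :=
          mul_le_mul_of_nonneg_left h3 (by linarith)
      _ ≤ _ := mul_le_mul_of_nonpos_right h5 h4
  have h6 : (n : ℝ) * Real.log n ≥ n * 100 := by gcongr
  have h7 : (n : ℝ) * Real.log 2 ≤ n * 0.6931471808 := by gcongr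
  nlinarith

lemma sparse_term_le {n r : ℕ} {x : ℝ} (hx : 1 ≤ Real.log x) (hx0 : 0 < x)
    (hn : 100 ≤ Real.log n) (hn' : Real.log n ^ 8 ≤ n)
    (hxn : Real.log x ^ 2 ≤ n * Real.log n / 640000) (hr : (2 : ℝ) ^ (8 * r) ≤ n) :
    (n * x) ^ (2 * 4 ^ r * (2 * r)) * (3 / 4) ^ (n - 2 * 4 ^ r * (2 * r)) ≤
      Real.exp (-(n / 8)) := by
  have hn0 : (0 : ℝ) < n := lt_of_lt_of_le (by positivity) hr
  have h4 : (4 : ℝ) ^ r = (2 ^ r) ^ 2 := by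
    rw [← pow_mul, mul_comm, pow_mul]
    norm_num
  set L := Real.log n with hL
  have hlog2' := Real.log_two_gt_d9
  have hrL : (r : ℝ) ≤ L / 5 := by
    have := Real.log_le_log (by positivity) hr
    rw [Real.log_pow] at this
    push_cast at this
    nlinarith [(Nat.cast_nonneg r : (0 : ℝ) ≤ r)]
  have hlog34 : Real.log (3 / 4) ≤ -(1 / 4) := by
    have := Real.log_le_sub_one_of_pos (x := 3 / 4) (by norm_num)
    linarith
  set t := Real.sqrt n with ht
  have htn : t ^ 2 = n := Real.sq_sqrt hn0.le
  have ht0 : 0 < t := Real.sqrt_pos.2 hn0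
  have hLt : L ^ 4 ≤ t := by
    refine le_of_sq_le_sq ?_ ht0.le
    rw [htn, ← pow_mul]
    exact hn'
  have hyt : ((2 : ℝ) ^ r) ^ 4 ≤ t := by
    refine le_of_sq_le_sq ?_ ht0.le
    rw [htn, ← pow_mul, ← pow_mul]
    refine le_trans (le_of_eq ?_) hr
    congr 1
    ring
  have ht8 : 10 ^ 8 ≤ t := by
    refine le_trans ?_ hLt
    calc (10 : ℝ) ^ 8 = 100 ^ 4 := by norm_num
      _ ≤ L ^ 4 := by gcongr
  have hL3 : L ^ 3 ≤ t / 100 := by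
    have : 100 * L ^ 3 ≤ L * L ^ 3 := by gcongr
    nlinarith
  set s := ((2 * 4 ^ r * (2 * r) : ℕ) : ℝ) with hs
  have hs0 : 0 ≤ s := Nat.cast_nonneg _
  have hs2 : s ^ 2 ≤ 16 / 25 * L ^ 2 * t := by
    calc s ^ 2 = 16 * (r : ℝ) ^ 2 * (2 ^ r) ^ 4 := by
          rw [hs]
          push_cast
          rw [h4]
          ring
      _ ≤ 16 * (L / 5) ^ 2 * t := by gcongr
      _ = _ := by ring
  have hsL : s * (L + Real.log x) ≤ n / 16 := by
    refine le_of_sq_le_sq ?_ (by positivity)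
    calc (s * (L + Real.log x)) ^ 2 = s ^ 2 * (L + Real.log x) ^ 2 := by ring
      _ ≤ s ^ 2 * (2 * L ^ 2 + 2 * Real.log x ^ 2) := by
          gcongr
          nlinarith [sq_nonneg (L - Real.log x)]
      _ ≤ (16 / 25 * L ^ 2 * t) * (2 * L ^ 2 + 2 * (n * L / 640000)) := by gcongr
      _ = 32 / 25 * (L ^ 4 * t) + 32 / 25 / 640000 * (L ^ 3 * (t * n)) := by ring
      _ ≤ 32 / 25 * (t * t) + 32 / 25 / 640000 * (t / 100 * (t * n)) := by gcongr
      _ = 32 / 25 * n + 32 / 25 / 64000000 * n ^ 2 := by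
          rw [← htn]
          ring
      _ ≤ (n / 16) ^ 2 := by
          have : (10 : ℝ) ^ 8 ≤ n := by
            rw [← htn]
            nlinarith
          nlinarith
  have hsn : s ≤ n / 16 := by nlinarith
  have hsn' : 2 * 4 ^ r * (2 * r) ≤ n := by
    have : s ≤ n := by linarith
    exact Nat.cast_le.1 this
  rw [← Real.log_le_iff_le_exp (by positivity), Real.log_mul (by positivity) (by positivity),
    Real.log_pow, Real.log_pow, Real.log_mul (by positivity) (by positivity), Nat.cast_sub hsn',
    ← hs, ← hL]
  nlinarith

lemma eventually_log_bounds :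
    ∀ᶠ n : ℕ in Filter.atTop, 2 ^ 16 ≤ n ∧ 100 ≤ Real.log n ∧ Real.log n ^ 8 ≤ n := by
  have h1 : Filter.Tendsto (fun n : ℕ => (n : ℝ)) Filter.atTop Filter.atTop :=
    tendsto_natCast_atTop_atTop
  have h2 := (Real.isLittleO_pow_log_id_atTop (n := 8)).bound one_pos
  filter_upwards [Filter.eventually_ge_atTop (2 ^ 16),
    (Real.tendsto_log_atTop.comp h1).eventually_ge_atTop 100, h1.eventually h2] with n hn hn1 hn2
  refine ⟨hn, hn1, ?_⟩
  simpa using (le_abs_self _).trans hn2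

end Asymptotics

lemma sum_maxProb_le_exp {n : ℕ} (hn : 2 ^ 16 ≤ n) (hlog : 100 ≤ Real.log n)
    (hlog' : Real.log n ^ 8 ≤ n)
    (hpn : (p : ℝ) ≤ Real.exp ((1 / 800 : ℝ) * Real.sqrt (n * Real.log n)))
    (hp : (n : ℝ) / 2 ≤ p) (V : Finset (Fin n → ZMod p))
    (hV : ∀ v ∈ V, v ≠ 0 ∧ 4 / (p : ℝ) ≤ retProb v univ) :
    ∑ v ∈ V, maxProb v ≤ Real.exp (-(1 / 800 : ℝ) * n) := by
  have hp0 := natCast_pos (p := p)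
  have hnR : (2 : ℝ) ^ 16 ≤ n := by exact_mod_cast hn
  have hn0 : n ≠ 0 := by omega
  have hp2 : p ≠ 2 := by
    rintro rfl
    push_cast at hp
    linarith
  have hℓ : 1 ≤ Real.log p := by
    rw [Real.le_log_iff_exp_le hp0]
    linarith [Real.exp_one_lt_d9]
  have hℓ2 : Real.log p ^ 2 ≤ n * Real.log n / 640000 := by
    have h1 : Real.log p ≤ 1 / 800 * Real.sqrt (n * Real.log n) :=
      (Real.log_le_iff_le_exp hp0).2 hpn
    have h2 : Real.sqrt (n * Real.log n) ^ 2 = n * Real.log n := Real.sq_sqrt (by positivity)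
    calc Real.log p ^ 2 ≤ (1 / 800 * Real.sqrt (n * Real.log n)) ^ 2 := by gcongr
      _ = _ := by rw [mul_pow, h2]; ring
  set r := Nat.log 2 n / 8 with hr
  have hr2 : 2 ≤ r := by
    have := Nat.le_log_of_pow_le (b := 2) (by norm_num) hn
    omega
  have hrn : (2 : ℝ) ^ (8 * r) ≤ n := by
    have h1 : 2 ^ (8 * r) ≤ n :=
      (Nat.pow_le_pow_right (by norm_num) (by omega)).trans (Nat.pow_log_le_self 2 hn0)
    exact_mod_cast h1
  have hrn' : (n : ℝ) ≤ 2 ^ (8 * r + 8) := by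
    have h1 : n ≤ 2 ^ (8 * r + 8) :=
      (Nat.lt_pow_succ_log_self (b := 2) (by norm_num) n).le.trans
        (Nat.pow_le_pow_right (by norm_num) (by omega))
    exact_mod_cast h1
  have hpr : (2 : ℝ) ^ r ≤ p := by
    refine le_trans ?_ hp
    rw [le_div_iff₀ (by norm_num), ← pow_succ]
    exact (pow_le_pow_right₀ (by norm_num) (by omega)).trans hrn
  set q := ⌈2 * Real.log p⌉₊ with hq
  set D := q + ⌈8 * Real.log p⌉₊ with hD
  have hq1 : 2 * Real.log p ≤ q := Nat.le_ceil _
  have hD1 : q + 8 * Real.log p ≤ D := by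
    rw [hD]
    push_cast
    linarith [Nat.le_ceil (8 * Real.log p)]
  have hD2 : (D : ℝ) ≤ 12 * Real.log p := by
    rw [hD]
    push_cast
    have h1 := Nat.ceil_lt_add_one (a := 8 * Real.log p) (by linarith)
    have h2 := Nat.ceil_lt_add_one (a := 2 * Real.log p) (by linarith)
    linarith
  refine (sum_maxProb_le hp2 (by omega) hq1 hD1 hpr hr2 V hV).trans ?_
  refine (add_le_add (captured_term_le hℓ hp0 hlog hℓ2 hD2 hrn hrn')
    (sparse_term_le hℓ hp0 hlog hlog' hℓ2 hrn)).trans ?_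
  have h1 : Real.exp (-(n : ℝ)) ≤ Real.exp (-(n / 8)) := Real.exp_le_exp.2 (by linarith)
  have h2 : 2 ≤ Real.exp ((n : ℝ) * (99 / 800)) :=
    le_trans (by linarith) (Real.add_one_le_exp _)
  calc _ ≤ 2 * Real.exp (-((n : ℝ) / 8)) := by linarith
    _ ≤ Real.exp ((n : ℝ) * (99 / 800)) * Real.exp (-((n : ℝ) / 8)) := by gcongr
    _ = _ := by
      rw [← Real.exp_add]
      congr 1
      ring

end LazyWalk

open scoped Classical in
/-- **Theorem 1.5.** Let `c = 1/800`, `n` sufficiently large, and `p ≤ exp(c√(n log n))` prime.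
Then for every `β` with `n/(2p) ≤ β ≤ 2n/p`,
`∑_{v ≠ 0, ρ(v) ≥ β} max_w P(M_n v = w) ≤ e^{-cn}`. Here `ρ = rho 1` corresponds to
i.i.d. uniform `±1` coefficients. -/
theorem sum_over_structured_vectors :
    ∃ N : ℕ, ∀ n : ℕ, N ≤ n → ∀ (p : ℕ) [Fact p.Prime],
      (p : ℝ) ≤ Real.exp ((1 / 800 : ℝ) * Real.sqrt (n * Real.log n)) →
      ∀ β : ℝ, (n : ℝ) / (2 * p) ≤ β → β ≤ 2 * n / p →
        ∑ v ∈ Finset.univ.filter fun v : Fin n → ZMod p => v ≠ 0 ∧ β ≤ rho 1 v,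
          ⨆ w : Fin n → ZMod p,
            symPr n {A | (A.map (Int.cast : ℤ → ZMod p)).mulVec v = w} ≤
          Real.exp (-(1 / 800 : ℝ) * n) := by
  obtain ⟨N, hN⟩ := Filter.eventually_atTop.1 LazyWalk.eventually_log_bounds
  refine ⟨N, fun n hn p _ hpn β hβ _ => ?_⟩
  obtain ⟨hn1, hn2, hn3⟩ := hN n hn
  have hp0 := LazyWalk.natCast_pos (p := p)
  have hret : ∀ v ∈ Finset.univ.filter (fun v : Fin n → ZMod p => v ≠ 0 ∧ β ≤ rho 1 v),
      (n : ℝ) / (2 * p) ≤ LazyWalk.retProb v Finset.univ := fun v hv =>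
    hβ.trans ((Finset.mem_filter.1 hv).2.2.trans (LazyWalk.rho_one_le_retProb v))
  obtain hV | ⟨v₀, hv₀⟩ := Finset.eq_empty_or_nonempty
    (Finset.univ.filter fun v : Fin n → ZMod p => v ≠ 0 ∧ β ≤ rho 1 v)
  · rw [hV, Finset.sum_empty]
    exact (Real.exp_pos _).le
  have hp : (n : ℝ) / 2 ≤ p := by
    have h1 := (hret v₀ hv₀).trans (LazyWalk.retProb_le_one _ _)
    rw [div_le_one (by positivity)] at h1
    linarith
  refine LazyWalk.sum_maxProb_le_exp hn1 hn2 hn3 hpn hp _ fun v hv =>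
    ⟨(Finset.mem_filter.1 hv).2.1, le_trans ?_ (hret v hv)⟩
  have h8 : (8 : ℝ) ≤ n := by exact_mod_cast (by omega : 8 ≤ n)
  rw [div_le_div_iff₀ hp0 (by positivity)]
  nlinarith
end

section
/- Let n be a positive integer and let p > 2 be a prime. Then for every β > 0, P(det(M_n) = 0) ≤ n · Σ_{m = n-1}^{2n-3} ( β^{1/8} + q_m(β)/β ). -/
open scoped Classical in
/-- `q p m β = max_w P(∃ v ≠ 0 with M_m v = w and ρ(v) ≥ β)`, where `M_m` is a uniformly
random `m × m` symmetric `±1` matrix and the product `M_m v` is over `ℤ/pℤ`. -/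
noncomputable def q (p : ℕ) [NeZero p] (m : ℕ) (β : ℝ) : ℝ :=
  ⨆ w : Fin m → ZMod p,
    symPr m {A | ∃ v : Fin m → ZMod p, v ≠ 0 ∧
      (A.map (Int.cast : ℤ → ZMod p)).mulVec v = w ∧ β ≤ rho 1 v}

/-- The finset of symmetric `n × n` matrices with entries in `{-1, 1}`. -/
noncomputable def signSymm (n : ℕ) : Finset (Matrix (Fin n) (Fin n) ℤ) :=
  open scoped Classical in
  ((Fintype.piFinset fun _ : Fin n => Fintype.piFinset fun _ : Fin n => ({1, -1} : Finset ℤ)).map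
    Matrix.of.toEmbedding).filter Matrix.IsSymm

theorem mem_signSymm {n : ℕ} {A : Matrix (Fin n) (Fin n) ℤ} :
    A ∈ signSymm n ↔ A.IsSymm ∧ ∀ i j, A i j = 1 ∨ A i j = -1 := by
  classical
  unfold signSymm
  rw [Finset.mem_filter, and_comm, Finset.mem_map_equiv]
  simp [Fintype.mem_piFinset]

theorem signSymm_nonempty (n : ℕ) : (signSymm n).Nonempty :=
  ⟨Matrix.of fun _ _ => 1, mem_signSymm.2 ⟨by ext; simp, by simp⟩⟩

theorem symPr_eq_sum (n : ℕ) (P : Matrix (Fin n) (Fin n) ℤ → Prop) [DecidablePred P] :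
    symPr n {A | P A} = (∑ A ∈ signSymm n, if P A then (1 : ℝ) else 0) / (signSymm n).card := by
  have h1 : {A : Matrix (Fin n) (Fin n) ℤ |
      (A.IsSymm ∧ ∀ i j, A i j = 1 ∨ A i j = -1) ∧ A ∈ {A | P A}}
        = ((signSymm n).filter P : Finset _) := by
    ext A; simp [mem_signSymm]
  have h2 : {A : Matrix (Fin n) (Fin n) ℤ | A.IsSymm ∧ ∀ i j, A i j = 1 ∨ A i j = -1}
      = (signSymm n : Finset _) := by
    ext A; simp [mem_signSymm]
  unfold symPr
  rw [h1, h2, Finset.sum_boole]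
  simp only [SetLike.coe_sort_coe, Nat.card_eq_fintype_card, Fintype.card_coe]

/-- The matrix obtained from `M` by inserting at index `i` the row and column `X`
with diagonal entry `x`. -/
def bordered {R : Type} {m : ℕ} (i : Fin (m + 1)) (x : R) (X : Fin m → R)
    (M : Matrix (Fin m) (Fin m) R) : Matrix (Fin (m + 1)) (Fin (m + 1)) R :=
  Matrix.of (Fin.insertNth (α := fun _ => Fin (m + 1) → R) i
    (Fin.insertNth (α := fun _ => R) i x X)
    (fun a => Fin.insertNth (α := fun _ => R) i (X a) (M a)))

section bordered

variable {R : Type} {m : ℕ} (i : Fin (m + 1)) (x : R) (X : Fin m → R)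
    (M : Matrix (Fin m) (Fin m) R) (a b : Fin m)

@[simp] theorem bordered_same_same : bordered i x X M i i = x := by simp [bordered]

@[simp] theorem bordered_same_succAbove : bordered i x X M i (i.succAbove b) = X b := by
  simp [bordered]

@[simp] theorem bordered_succAbove_same : bordered i x X M (i.succAbove a) i = X a := by
  simp [bordered]

@[simp] theorem bordered_succAbove_succAbove :
    bordered i x X M (i.succAbove a) (i.succAbove b) = M a b := by
  simp [bordered]

theorem ext_succAbove {A B : Matrix (Fin (m + 1)) (Fin (m + 1)) R} (h : A i i = B i i)
    (hr : ∀ b, A i (i.succAbove b) = B i (i.succAbove b))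
    (hc : ∀ a, A (i.succAbove a) i = B (i.succAbove a) i)
    (hM : ∀ a b, A (i.succAbove a) (i.succAbove b) = B (i.succAbove a) (i.succAbove b)) :
    A = B := by
  ext a b
  cases a using Fin.succAboveCases i <;> cases b using Fin.succAboveCases i <;> simp [*]

end bordered

theorem bordered_mem_signSymm {m : ℕ} (i : Fin (m + 1)) (x : ℤˣ) (X : Fin m → ℤˣ)
    {M : Matrix (Fin m) (Fin m) ℤ} (hM : M ∈ signSymm m) :
    bordered i (x : ℤ) (fun j => (X j : ℤ)) M ∈ signSymm (m + 1) := by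
  rw [mem_signSymm] at hM ⊢
  constructor
  · apply ext_succAbove i <;> simp [Matrix.transpose_apply, hM.1.apply]
  · intro a b
    cases a using Fin.succAboveCases i <;> cases b using Fin.succAboveCases i <;>
      simp [hM.2, Units.val_eq_one, Units.val_eq_neg_one, Int.units_eq_one_or]

theorem sum_signSymm_succ {m : ℕ} (i : Fin (m + 1)) (f : Matrix (Fin (m + 1)) (Fin (m + 1)) ℤ → ℝ) :
    ∑ A ∈ signSymm (m + 1), f A = ∑ M ∈ signSymm m, ∑ x : ℤˣ, ∑ X : Fin m → ℤˣ,
      f (bordered i (x : ℤ) (fun j => (X j : ℤ)) M) := by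
  simp_rw [← Finset.sum_product', Finset.univ_product_univ]
  symm
  refine Finset.sum_bij (fun t _ => bordered i (t.2.1 : ℤ) (fun j => (t.2.2 j : ℤ)) t.1) ?_ ?_ ?_ ?_
  · intro t ht
    exact bordered_mem_signSymm i _ _ (Finset.mem_product.1 ht).1
  · rintro ⟨M, x, X⟩ - ⟨M', x', X'⟩ - h
    simp only at h
    refine Prod.ext ?_ (Prod.ext ?_ ?_)
    · ext a b
      simpa using congrFun (congrFun h (i.succAbove a)) (i.succAbove b)
    · simpa [Units.ext_iff] using congrFun (congrFun h i) i
    · funext b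
      simpa [Units.ext_iff] using congrFun (congrFun h i) (i.succAbove b)
  · intro A hA
    rw [mem_signSymm] at hA
    have hu : ∀ a b, IsUnit (A a b) := fun a b => Int.isUnit_iff.2 (hA.2 a b)
    refine ⟨(A.submatrix i.succAbove i.succAbove, (hu i i).unit,
      fun b => (hu i (i.succAbove b)).unit), ?_, ?_⟩
    · simp only [Finset.mem_product, Finset.mem_univ, and_true]
      exact mem_signSymm.2 ⟨hA.1.submatrix _, fun a b => hA.2 _ _⟩
    · apply ext_succAbove i <;> simp [hA.1.apply]
  · intros; rfl

theorem card_signSymm_succ (m : ℕ) :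
    ((signSymm (m + 1)).card : ℝ) = 2 * 2 ^ m * (signSymm m).card := by
  have := sum_signSymm_succ (m := m) 0 (fun _ => 1)
  simp only [Finset.sum_const, Finset.card_univ, Fintype.card_pi, Fintype.card_units_int,
    Finset.prod_const, Fintype.card_fin, nsmul_eq_mul, mul_one] at this
  rw [this]; push_cast; ring

/-- A sign vector, viewed over `ℤ/pℤ`. -/
def signVec (p : ℕ) {ι : Type} (X : ι → ℤˣ) : ι → ZMod p := fun i => ((X i : ℤ) : ZMod p)

theorem signVec_injective {p : ℕ} [Fact p.Prime] (hp : 2 < p) {ι : Type} :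
    Function.Injective (signVec p : (ι → ℤˣ) → ι → ZMod p) := by
  have : Fact (2 < p) := ⟨hp⟩
  have h := ZMod.neg_one_ne_one (n := p)
  intro X Y hXY
  funext i
  have := congrFun hXY i
  rcases Int.units_eq_one_or (X i) with hx | hx <;> rcases Int.units_eq_one_or (Y i) with hy | hy <;>
    simp_all [signVec, eq_comm]

section rho

variable {p : ℕ} [NeZero p] {ι : Type} [Fintype ι] [DecidableEq ι]

theorem probX_one (v : ι → ZMod p) (x : ZMod p) :
    probX 1 v x = (Finset.univ.filter fun X : ι → ℤˣ => signVec p X ⬝ᵥ v = x).card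
      / 2 ^ Fintype.card ι := by
  have hmem : ∀ u : ℤˣ, (u : ℤ) ∈ ({-1, 0, 1} : Finset ℤ) := by
    intro u; rcases Int.units_eq_one_or u with h | h <;> simp [h]
  unfold probX
  rw [Finset.card_filter, Nat.cast_sum, Finset.sum_div]
  symm
  refine Finset.sum_of_injOn (fun X i => ⟨(X i : ℤ), hmem _⟩) ?_ (by simp) ?_ ?_
  · intro X _ Y _ h
    funext i
    simpa [Units.ext_iff] using congrFun h i
  · intro ε _ hε
    have : ∃ i, (ε i : ℤ) = 0 := by
      by_contra! h0
      refine hε ?_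
      have hu : ∀ i, IsUnit (ε i : ℤ) := by
        intro i
        have h1 := (ε i).2
        have h2 := h0 i
        simp only [Finset.mem_insert, Finset.mem_singleton] at h1
        rw [Int.isUnit_iff]; tauto
      exact ⟨fun i => (hu i).unit, by simp, by ext; simp⟩
    obtain ⟨i, hi⟩ := this
    rw [Finset.prod_eq_zero (Finset.mem_univ i) (by simp [hi]), zero_mul]
  · intro X _
    simp only [signVec, dotProduct]
    split_ifs with h <;> simp [h]

theorem card_dotProduct_eq_le (v : ι → ZMod p) (x : ZMod p) :
    ((Finset.univ.filter fun X : ι → ℤˣ => signVec p X ⬝ᵥ v = x).card : ℝ)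
      ≤ 2 ^ Fintype.card ι * rho 1 v := by
  have h := le_ciSup (Set.finite_range fun x => probX 1 v x).bddAbove x
  rw [probX_one, div_le_iff₀' (by positivity)] at h
  exact h

theorem inv_two_pow_le_rho (v : ι → ZMod p) : 1 / 2 ^ Fintype.card ι ≤ rho 1 v := by
  rw [div_le_iff₀' (by positivity)]
  refine le_trans ?_ (card_dotProduct_eq_le v (signVec p 1 ⬝ᵥ v))
  exact_mod_cast Finset.card_pos.2 ⟨1, by simp⟩

end rho

/-- Two applications of Cauchy–Schwarz bound the number of points of a subset of a product by
the number of combinatorial rectangles with all four corners in it. -/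
theorem sum_sum_pow_four_le {α γ : Type} [Fintype α] [Fintype γ] (f : α → γ → ℝ) :
    (∑ z, ∑ y, f z y) ^ 4 ≤ (Fintype.card α : ℝ) ^ 2 * (Fintype.card γ : ℝ) ^ 2 *
      ∑ z, ∑ z', ∑ y, ∑ y', f z y * f z' y * (f z y' * f z' y') := by
  have h1 : (∑ z, ∑ y, f z y) ^ 2 ≤ Fintype.card γ * ∑ y, (∑ z, f z y) ^ 2 := by
    rw [Finset.sum_comm]
    exact sq_sum_le_card_mul_sum_sq
  have h2 : ∑ y, (∑ z, f z y) ^ 2 = ∑ t : α × α, ∑ y, f t.1 y * f t.2 y := by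
    rw [Finset.sum_comm]
    refine Finset.sum_congr rfl fun y _ => ?_
    rw [sq, Finset.sum_mul_sum, Fintype.sum_prod_type]
  have h3 : (∑ t : α × α, ∑ y, f t.1 y * f t.2 y) ^ 2 ≤
      Fintype.card (α × α) * ∑ t : α × α, (∑ y, f t.1 y * f t.2 y) ^ 2 :=
    sq_sum_le_card_mul_sum_sq
  have h4 : ∑ t : α × α, (∑ y, f t.1 y * f t.2 y) ^ 2 =
      ∑ z, ∑ z', ∑ y, ∑ y', f z y * f z' y * (f z y' * f z' y') := by
    rw [Fintype.sum_prod_type]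
    refine Finset.sum_congr rfl fun z _ => Finset.sum_congr rfl fun z' _ => ?_
    rw [sq, Finset.sum_mul_sum]
  calc (∑ z, ∑ y, f z y) ^ 4 = ((∑ z, ∑ y, f z y) ^ 2) ^ 2 := by ring
    _ ≤ (Fintype.card γ * ∑ y, (∑ z, f z y) ^ 2) ^ 2 := by gcongr
    _ = (Fintype.card γ : ℝ) ^ 2 * (∑ t : α × α, ∑ y, f t.1 y * f t.2 y) ^ 2 := by
      rw [h2, mul_pow]
    _ ≤ (Fintype.card γ : ℝ) ^ 2 * (Fintype.card (α × α) * ∑ t : α × α,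
        (∑ y, f t.1 y * f t.2 y) ^ 2) := by gcongr
    _ = _ := by rw [h4, Fintype.card_prod]; push_cast; ring

section quadratic

variable {p : ℕ} [Fact p.Prime] {d e : ℕ}

theorem signVec_append (z : Fin d → ℤˣ) (y : Fin e → ℤˣ) :
    signVec p (Fin.append z y) = Fin.append (signVec p z) 0 + Fin.append 0 (signVec p y) := by
  funext i
  cases i using Fin.addCases <;> simp [signVec]

theorem append_sub_zero (a b : Fin d → ZMod p) :
    (Fin.append (a - b) 0 : Fin (d + e) → ZMod p) = Fin.append a 0 - Fin.append b 0 := by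
  funext i
  cases i using Fin.addCases <;> simp

theorem dotProduct_mulVec_of_corners {ι : Type} [Fintype ι] (hp : 2 < p)
    {G : Matrix ι ι (ZMod p)} (hG : G.IsSymm) {a : ZMod p} {z z' y y' : ι → ZMod p}
    (h1 : (z + y) ⬝ᵥ G.mulVec (z + y) = a) (h2 : (z' + y) ⬝ᵥ G.mulVec (z' + y) = a)
    (h3 : (z + y') ⬝ᵥ G.mulVec (z + y') = a) (h4 : (z' + y') ⬝ᵥ G.mulVec (z' + y') = a) :
    (y - y') ⬝ᵥ G.mulVec (z - z') = 0 := by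
  have hs : ∀ s t : ι → ZMod p, s ⬝ᵥ G.mulVec t = t ⬝ᵥ G.mulVec s := by
    intro s t
    rw [Matrix.dotProduct_mulVec, ← Matrix.mulVec_transpose, hG.eq, dotProduct_comm]
  simp only [add_dotProduct, Matrix.mulVec_add, dotProduct_add] at h1 h2 h3 h4
  rw [hs z y] at h1
  rw [hs z' y] at h2
  rw [hs z y'] at h3
  rw [hs z' y'] at h4
  simp only [sub_dotProduct, Matrix.mulVec_sub, dotProduct_sub]
  have h20 : (2 : ZMod p) ≠ 0 := by
    have : Fact (2 < p) := ⟨hp⟩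
    have := ZMod.neg_one_ne_one (n := p)
    intro h
    apply this
    linear_combination -h
  apply mul_left_cancel₀ h20
  linear_combination h1 - h2 - h3 + h4

theorem card_append_dotProduct_le (v : Fin (d + e) → ZMod p) (x : ZMod p) :
    ((Finset.univ.filter fun y : Fin e → ℤˣ => Fin.append 0 (signVec p y) ⬝ᵥ v = x).card : ℝ)
      ≤ 2 ^ (d + e) * rho 1 v := by
  have h := card_dotProduct_eq_le v (x + Fin.append (signVec p 1) 0 ⬝ᵥ v)
  rw [Fintype.card_fin] at h
  refine le_trans ?_ h
  rw [Nat.cast_le]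
  refine Finset.card_le_card_of_injOn (fun y => Fin.append 1 y) ?_ ?_
  · intro y hy
    simp only [Finset.coe_filter, Finset.mem_univ, true_and, Set.mem_ofPred_eq] at hy ⊢
    rw [signVec_append, add_dotProduct, hy, add_comm]
  · intro y _ y' _ h
    exact (Prod.ext_iff.1 ((Fin.appendEquiv d e).injective (a₁ := (1, y)) (a₂ := (1, y')) h)).2

end quadratic

open scoped Classical in
/-- The indicator of the event that `A v = w` has a nonzero structured solution `v`. -/
noncomputable def structuredInd (p : ℕ) [NeZero p] {m : ℕ} (β : ℝ) (w : Fin m → ZMod p)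
    (A : Matrix (Fin m) (Fin m) (ZMod p)) : ℝ :=
  if ∃ v : Fin m → ZMod p, v ≠ 0 ∧ A.mulVec v = w ∧ β ≤ rho 1 v then 1 else 0

theorem structuredInd_nonneg (p : ℕ) [NeZero p] {m : ℕ} (β : ℝ) (w : Fin m → ZMod p)
    (A : Matrix (Fin m) (Fin m) (ZMod p)) : 0 ≤ structuredInd p β w A := by
  unfold structuredInd; split_ifs <;> simp

open scoped Classical in
theorem sum_structuredInd_le (p : ℕ) [NeZero p] {m : ℕ} (β : ℝ) (w : Fin m → ZMod p) :
    ∑ M ∈ signSymm m, structuredInd p β w (M.map (Int.cast : ℤ → ZMod p))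
      ≤ q p m β * (signSymm m).card := by
  have hpos : (0 : ℝ) < (signSymm m).card := by exact_mod_cast (signSymm_nonempty m).card_pos
  have h : symPr m {A | ∃ v : Fin m → ZMod p, v ≠ 0 ∧
      (A.map (Int.cast : ℤ → ZMod p)).mulVec v = w ∧ β ≤ rho 1 v} ≤ q p m β :=
    le_ciSup (f := fun w : Fin m → ZMod p => symPr m {A | ∃ v : Fin m → ZMod p, v ≠ 0 ∧
      (A.map (Int.cast : ℤ → ZMod p)).mulVec v = w ∧ β ≤ rho 1 v})
      (Set.finite_range _).bddAbove w
  rw [symPr_eq_sum, div_le_iff₀ hpos] at h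
  exact h

theorem q_nonneg (p : ℕ) [NeZero p] (m : ℕ) (β : ℝ) : 0 ≤ q p m β := by
  have hpos : (0 : ℝ) < (signSymm m).card := by exact_mod_cast (signSymm_nonempty m).card_pos
  have h := sum_structuredInd_le p (m := m) β 0
  exact nonneg_of_mul_nonneg_left
    ((Finset.sum_nonneg fun _ _ => structuredInd_nonneg _ _ _ _).trans h) hpos

theorem half_le_q {p : ℕ} [Fact p.Prime] {m : ℕ} (hm : 0 < m) {β : ℝ} (hβ : β ≤ 1 / 2 ^ m) :
    1 / 2 ≤ q p m β := by
  have hpos : (0 : ℝ) < (signSymm m).card := by exact_mod_cast (signSymm_nonempty m).card_pos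
  have hrho : ∀ v : Fin m → ZMod p, β ≤ rho 1 v := fun v =>
    hβ.trans (by simpa using inv_two_pow_le_rho v)
  have h0 := sum_structuredInd_le p (m := m) β 0
  have h1 := sum_structuredInd_le p (m := m) β 1
  have h : ∀ M ∈ signSymm m, (1 : ℝ) ≤ structuredInd p β 0 (M.map (Int.cast : ℤ → ZMod p))
      + structuredInd p β 1 (M.map (Int.cast : ℤ → ZMod p)) := by
    intro M _
    by_cases hd : (M.map (Int.cast : ℤ → ZMod p)).det = 0
    · obtain ⟨v, hv, hv0⟩ := Matrix.exists_mulVec_eq_zero_iff.2 hd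
      have : structuredInd p β 0 (M.map (Int.cast : ℤ → ZMod p)) = 1 :=
        if_pos ⟨v, hv, hv0, hrho v⟩
      rw [this]
      linarith [structuredInd_nonneg p β 1 (M.map (Int.cast : ℤ → ZMod p))]
    · have hsol : (M.map (Int.cast : ℤ → ZMod p)).mulVec
          ((M.map (Int.cast : ℤ → ZMod p))⁻¹.mulVec 1) = 1 := by
        rw [Matrix.mulVec_mulVec, Matrix.mul_nonsing_inv _ (isUnit_iff_ne_zero.2 hd),
          Matrix.one_mulVec]
      have : structuredInd p β 1 (M.map (Int.cast : ℤ → ZMod p)) = 1 := by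
        refine if_pos ⟨_, fun hv => ?_, hsol, hrho _⟩
        rw [hv, Matrix.mulVec_zero] at hsol
        exact zero_ne_one (congrFun hsol ⟨0, hm⟩)
      rw [this]
      linarith [structuredInd_nonneg p β 0 (M.map (Int.cast : ℤ → ZMod p))]
  have h2 := Finset.sum_le_sum h
  rw [Finset.sum_add_distrib, Finset.sum_const, nsmul_eq_mul, mul_one] at h2
  nlinarith

section quadratic

variable {p : ℕ} [Fact p.Prime] {d e : ℕ}

theorem sum_sum_ite_append_sub_le (v : Fin (d + e) → ZMod p) :
    ∑ y : Fin e → ℤˣ, ∑ y' : Fin e → ℤˣ,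
      (if (Fin.append 0 (signVec p y) - Fin.append 0 (signVec p y')) ⬝ᵥ v = 0 then (1 : ℝ) else 0)
      ≤ 2 ^ e * (2 ^ (d + e) * rho 1 v) := by
  rw [Finset.sum_comm]
  have h : ∀ y' ∈ (Finset.univ : Finset (Fin e → ℤˣ)), ∑ y : Fin e → ℤˣ,
      (if (Fin.append 0 (signVec p y) - Fin.append 0 (signVec p y')) ⬝ᵥ v = 0 then (1 : ℝ) else 0)
      ≤ 2 ^ (d + e) * rho 1 v := by
    intro y' _
    simp only [sub_dotProduct, sub_eq_zero]
    rw [Finset.sum_boole]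
    exact card_append_dotProduct_le v _
  refine (Finset.sum_le_card_nsmul _ _ _ h).trans_eq ?_
  simp

theorem card_quadratic_pow_four_le (hp : 2 < p) {β : ℝ} (hβ : 0 ≤ β)
    {A : Matrix (Fin (d + e)) (Fin (d + e)) (ZMod p)} (hA : A.IsSymm) (hdet : A.det ≠ 0)
    (a : ZMod p) :
    ((Finset.univ.filter fun X : Fin (d + e) → ℤˣ =>
      signVec p X ⬝ᵥ A⁻¹.mulVec (signVec p X) = a).card : ℝ) ^ 4 ≤
      (2 ^ (d + e)) ^ 2 * (2 ^ d * (2 ^ e) ^ 2 + (2 ^ d) ^ 3 * (2 ^ e) ^ 2 * β + (2 ^ e) ^ 2 *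
        ∑ z : Fin d → ℤˣ, ∑ z' : Fin d → ℤˣ,
          structuredInd p β (Fin.append (signVec p z - signVec p z') 0) A) := by
  set f : (Fin d → ℤˣ) → (Fin e → ℤˣ) → ℝ := fun z y =>
    if signVec p (Fin.append z y) ⬝ᵥ A⁻¹.mulVec (signVec p (Fin.append z y)) = a then 1 else 0
  have hcard : ((Finset.univ.filter fun X : Fin (d + e) → ℤˣ =>
      signVec p X ⬝ᵥ A⁻¹.mulVec (signVec p X) = a).card : ℝ) = ∑ z, ∑ y, f z y := by
    rw [← Finset.sum_boole, ← (Fin.appendEquiv d e).sum_comp, Fintype.sum_prod_type]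
    rfl
  rw [hcard]
  refine (sum_sum_pow_four_le f).trans ?_
  simp only [Fintype.card_pi, Fintype.card_units_int, Finset.prod_const, Finset.card_univ,
    Fintype.card_fin]
  push_cast
  rw [← mul_pow, ← pow_add]
  gcongr
  have hrect : ∀ z z' : Fin d → ℤˣ,
      ∑ y, ∑ y', f z y * f z' y * (f z y' * f z' y') ≤
        (if z = z' then (2 ^ e) ^ 2 else 0) + 2 ^ e * (2 ^ (d + e) * β) +
        (2 ^ e) ^ 2 * structuredInd p β (Fin.append (signVec p z - signVec p z') 0) A := by
    intro z z'
    set w : Fin (d + e) → ZMod p := Fin.append (signVec p z - signVec p z') 0 with hw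
    have htriv : ∑ y, ∑ y', f z y * f z' y * (f z y' * f z' y') ≤ (2 ^ e) ^ 2 := by
      have h1 : ∀ y ∈ Finset.univ, ∀ y' ∈ Finset.univ, f z y * f z' y * (f z y' * f z' y') ≤ 1 := by
        intro y _ y' _
        simp only [f]
        split_ifs <;> norm_num
      refine (Finset.sum_le_card_nsmul _ _ (2 ^ e) fun y hy =>
        (Finset.sum_le_card_nsmul _ _ 1 (h1 y hy)).trans_eq ?_).trans_eq ?_
      · simp
      · simp [sq]
    have hb0 := structuredInd_nonneg p β w A
    by_cases hz : z = z'
    · rw [if_pos hz]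
      refine htriv.trans ?_
      rw [add_assoc]
      exact le_add_of_nonneg_right (by positivity)
    rw [if_neg hz, zero_add]
    by_cases hs : ∃ v : Fin (d + e) → ZMod p, v ≠ 0 ∧ A.mulVec v = w ∧ β ≤ rho 1 v
    · have : structuredInd p β w A = 1 := if_pos hs
      rw [this, mul_one]
      exact htriv.trans (le_add_of_nonneg_left (by positivity))
    have hsol : A.mulVec (A⁻¹.mulVec w) = w := by
      rw [Matrix.mulVec_mulVec, Matrix.mul_nonsing_inv _ (isUnit_iff_ne_zero.2 hdet),
        Matrix.one_mulVec]
    have hw0 : w ≠ 0 := by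
      intro h
      apply hz
      apply signVec_injective hp
      funext i
      have := congrFun h (Fin.castAdd e i)
      simpa [hw, sub_eq_zero] using this
    have hrho : rho 1 (A⁻¹.mulVec w) ≤ β := by
      by_contra! hlt
      refine hs ⟨_, fun hv => hw0 ?_, hsol, hlt.le⟩
      rw [← hsol, hv, Matrix.mulVec_zero]
    have hcorner : ∑ y, ∑ y', f z y * f z' y * (f z y' * f z' y') ≤
        ∑ y : Fin e → ℤˣ, ∑ y' : Fin e → ℤˣ,
          (if (Fin.append 0 (signVec p y) - Fin.append 0 (signVec p y')) ⬝ᵥ A⁻¹.mulVec w = 0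
            then (1 : ℝ) else 0) := by
      refine Finset.sum_le_sum fun y _ => Finset.sum_le_sum fun y' _ => ?_
      by_cases h : signVec p (Fin.append z y) ⬝ᵥ A⁻¹.mulVec (signVec p (Fin.append z y)) = a ∧
          signVec p (Fin.append z' y) ⬝ᵥ A⁻¹.mulVec (signVec p (Fin.append z' y)) = a ∧
          signVec p (Fin.append z y') ⬝ᵥ A⁻¹.mulVec (signVec p (Fin.append z y')) = a ∧
          signVec p (Fin.append z' y') ⬝ᵥ A⁻¹.mulVec (signVec p (Fin.append z' y')) = a
      · obtain ⟨h1, h2, h3, h4⟩ := h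
        have hinv : A⁻¹.IsSymm := by
          rw [Matrix.IsSymm, Matrix.transpose_nonsing_inv, hA.eq]
        have h0 : (Fin.append 0 (signVec p y) - Fin.append 0 (signVec p y')) ⬝ᵥ
            A⁻¹.mulVec w = 0 := by
          simp only [signVec_append] at h1 h2 h3 h4
          rw [hw, append_sub_zero]
          exact dotProduct_mulVec_of_corners hp hinv h1 h2 h3 h4
        simp [f, h1, h2, h3, h4, h0]
      · have : f z y * f z' y * (f z y' * f z' y') = 0 := by
          by_contra hne
          apply h
          simp only [f, mul_ne_zero_iff, ite_ne_right_iff] at hne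
          tauto
        rw [this]
        split_ifs <;> norm_num
    refine (hcorner.trans (sum_sum_ite_append_sub_le _)).trans ?_
    have : (2 : ℝ) ^ e * (2 ^ (d + e) * rho 1 (A⁻¹.mulVec w)) ≤ 2 ^ e * (2 ^ (d + e) * β) := by
      gcongr
    exact this.trans (le_add_of_nonneg_right (by positivity))
  refine (Finset.sum_le_sum fun z _ => Finset.sum_le_sum fun z' _ => hrect z z').trans_eq ?_
  simp only [Finset.sum_add_distrib, ← Finset.mul_sum, Finset.sum_ite_eq, Finset.mem_univ, if_true,
    Finset.sum_const, Finset.card_univ, Fintype.card_pi, Fintype.card_units_int,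
    Finset.prod_const, Fintype.card_fin, nsmul_eq_mul]
  push_cast
  ring

open scoped Classical in
theorem card_border_le (hp : 2 < p) {s : ℝ} (hs : 0 < s) {β : ℝ} (hβ : β = s ^ 8)
    (hd1 : 2 ^ d * s ^ 4 ≤ 1) (hd2 : 1 ≤ 2 * 2 ^ d * s ^ 4)
    {A : Matrix (Fin (d + e)) (Fin (d + e)) (ZMod p)} (hA : A.IsSymm) (a : ZMod p) :
    ((Finset.univ.filter fun X : Fin (d + e) → ℤˣ =>
      ∃ y, A.mulVec y = signVec p X ∧ signVec p X ⬝ᵥ y = a).card : ℝ) ≤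
      2 ^ (d + e) * (3 * s / 2 + s ^ 8 + structuredInd p β 0 A + 1 / (4 * s ^ 3) *
        ((∑ z : Fin d → ℤˣ, ∑ z' : Fin d → ℤˣ,
          structuredInd p β (Fin.append (signVec p z - signVec p z') 0) A) / (2 ^ d) ^ 2)) := by
  have hβ0 : 0 ≤ β := by rw [hβ]; positivity
  set B := ∑ z : Fin d → ℤˣ, ∑ z' : Fin d → ℤˣ,
          structuredInd p β (Fin.append (signVec p z - signVec p z') 0) A with hB
  have hB0 : 0 ≤ B := Finset.sum_nonneg fun _ _ => Finset.sum_nonneg fun _ _ =>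
    structuredInd_nonneg _ _ _ _
  have hb0 := structuredInd_nonneg p β 0 A
  set b := structuredInd p β 0 A with hb
  clear_value b B
  by_cases hdet : A.det = 0
  · obtain ⟨u, hu, hu0⟩ := Matrix.exists_mulVec_eq_zero_iff.2 hdet
    by_cases hst : ∃ v : Fin (d + e) → ZMod p, v ≠ 0 ∧ A.mulVec v = 0 ∧ β ≤ rho 1 v
    · have h1 : b = 1 := hb.trans (if_pos hst)
      have hc : ((Finset.univ.filter fun X : Fin (d + e) → ℤˣ =>
          ∃ y, A.mulVec y = signVec p X ∧ signVec p X ⬝ᵥ y = a).card : ℝ) ≤ 2 ^ (d + e) := by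
        have hcard : Fintype.card (Fin (d + e) → ℤˣ) = 2 ^ (d + e) := by simp
        have h := Finset.card_le_univ (Finset.univ.filter fun X : Fin (d + e) → ℤˣ =>
          ∃ y, A.mulVec y = signVec p X ∧ signVec p X ⬝ᵥ y = a)
        rw [hcard] at h
        exact_mod_cast h
      refine hc.trans (le_mul_of_one_le_right (by positivity) ?_)
      rw [h1]
      have : 0 ≤ 3 * s / 2 + s ^ 8 + 1 / (4 * s ^ 3) * (B / (2 ^ d) ^ 2) := by positivity
      linarith
    · have hrho : rho 1 u ≤ β := by
        by_contra! hlt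
        exact hst ⟨u, hu, hu0, hlt.le⟩
      have hsub : (Finset.univ.filter fun X : Fin (d + e) → ℤˣ =>
          ∃ y, A.mulVec y = signVec p X ∧ signVec p X ⬝ᵥ y = a) ⊆
          Finset.univ.filter fun X : Fin (d + e) → ℤˣ => signVec p X ⬝ᵥ u = 0 := by
        intro X hX
        simp only [Finset.mem_filter, Finset.mem_univ, true_and] at hX ⊢
        obtain ⟨y, hy, -⟩ := hX
        rw [← hy, dotProduct_comm, Matrix.dotProduct_mulVec, ← Matrix.mulVec_transpose, hA.eq, hu0,
          zero_dotProduct]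
      have hc : ((Finset.univ.filter fun X : Fin (d + e) → ℤˣ =>
          ∃ y, A.mulVec y = signVec p X ∧ signVec p X ⬝ᵥ y = a).card : ℝ) ≤
          2 ^ (d + e) * rho 1 u := by
        refine le_trans ?_ (by simpa using card_dotProduct_eq_le u 0)
        exact_mod_cast Finset.card_le_card hsub
      refine hc.trans ?_
      gcongr
      have : 0 ≤ 3 * s / 2 + b + 1 / (4 * s ^ 3) * (B / (2 ^ d) ^ 2) := by
        positivity
      linarith
  · have hq := card_quadratic_pow_four_le hp hβ0 hA hdet a
    rw [← hB] at hq
    have hsub : (Finset.univ.filter fun X : Fin (d + e) → ℤˣ =>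
          ∃ y, A.mulVec y = signVec p X ∧ signVec p X ⬝ᵥ y = a) ⊆
          Finset.univ.filter fun X : Fin (d + e) → ℤˣ =>
            signVec p X ⬝ᵥ A⁻¹.mulVec (signVec p X) = a := by
      intro X hX
      simp only [Finset.mem_filter, Finset.mem_univ, true_and] at hX ⊢
      obtain ⟨y, hy, rfl⟩ := hX
      congr 1
      rw [← hy, Matrix.mulVec_mulVec, Matrix.nonsing_inv_mul _ (isUnit_iff_ne_zero.2 hdet),
        Matrix.one_mulVec]
    refine (Nat.cast_le.2 (Finset.card_le_card hsub)).trans ?_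
    set N : ℝ := ((Finset.univ.filter fun X : Fin (d + e) → ℤˣ =>
      signVec p X ⬝ᵥ A⁻¹.mulVec (signVec p X) = a).card : ℝ)
    set D : ℝ := 2 ^ d with hD
    set E : ℝ := 2 ^ e with hE
    have hDpos : 0 < D := by positivity
    have hEpos : 0 < E := by positivity
    rw [pow_add, ← hD, ← hE] at hq ⊢
    set g := N / (D * E) with hg
    have hN : N = D * E * g := by rw [hg]; field_simp
    have hg4 : g ^ 4 ≤ 1 / D + D * β + B / D ^ 2 := by
      rw [hg, div_pow, div_le_iff₀ (by positivity)]
      refine hq.trans_eq ?_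
      field_simp
    have hDs : 1 / D + D * β ≤ 3 * s ^ 4 := by
      have h1 : 1 / D ≤ 2 * s ^ 4 := by rw [div_le_iff₀ hDpos]; linarith
      have h2 : D * β ≤ s ^ 4 := by
        rw [hβ]
        have : D * s ^ 4 * s ^ 4 ≤ 1 * s ^ 4 := by gcongr
        calc D * s ^ 8 = D * s ^ 4 * s ^ 4 := by ring
          _ ≤ _ := this
          _ = _ := one_mul _
      linarith
    have hamgm : g ≤ 3 * s / 4 + g ^ 4 / (4 * s ^ 3) := by
      have : 4 * s ^ 3 * g ≤ 3 * s ^ 4 + g ^ 4 := by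
        nlinarith [sq_nonneg (g ^ 2 - s ^ 2), mul_nonneg (sq_nonneg s) (sq_nonneg (g - s))]
      have h2 : g ≤ (3 * s ^ 4 + g ^ 4) / (4 * s ^ 3) := by
        rw [le_div_iff₀ (by positivity)]; linarith
      refine h2.trans_eq ?_
      field_simp
    rw [hN]
    gcongr
    have h3 : g ^ 4 / (4 * s ^ 3) ≤ (3 * s ^ 4 + B / D ^ 2) / (4 * s ^ 3) := by
      gcongr; linarith
    have h4 : (3 * s ^ 4 + B / D ^ 2) / (4 * s ^ 3) = 3 * s / 4 + 1 / (4 * s ^ 3) * (B / D ^ 2) := by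
      field_simp
    have : 0 ≤ s ^ 8 := by positivity
    linarith

end quadratic

theorem exists_mulVec_eq_of_bordered {F : Type} [Field F] {m : ℕ} {i : Fin (m + 1)} {x : F}
    {X : Fin m → F} {M : Matrix (Fin m) (Fin m) F} {v : Fin (m + 1) → F}
    (hv : (bordered i x X M).mulVec v = 0) (hvi : v i ≠ 0) :
    ∃ y, M.mulVec y = X ∧ X ⬝ᵥ y = x := by
  have h0 := congrFun hv i
  simp only [Matrix.mulVec, dotProduct, Fin.sum_univ_succAbove _ i, bordered_same_same,
    bordered_same_succAbove, Pi.zero_apply] at h0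
  refine ⟨-(v i)⁻¹ • fun b => v (i.succAbove b), ?_, ?_⟩
  · funext a
    have ha := congrFun hv (i.succAbove a)
    simp only [Matrix.mulVec, dotProduct, Fin.sum_univ_succAbove _ i, bordered_succAbove_same,
      bordered_succAbove_succAbove, Pi.zero_apply] at ha
    rw [Matrix.mulVec_smul, Pi.smul_apply, Matrix.mulVec, dotProduct, smul_eq_mul,
      eq_neg_of_add_eq_zero_right ha]
    field_simp
  · rw [dotProduct_smul, dotProduct, smul_eq_mul, eq_neg_of_add_eq_zero_right h0]
    field_simp

theorem bordered_map_cast {R : Type} [Ring R] {m : ℕ} (i : Fin (m + 1)) (x : ℤ) (X : Fin m → ℤ)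
    (M : Matrix (Fin m) (Fin m) ℤ) :
    (bordered i x X M).map (Int.cast : ℤ → R) =
      bordered i (x : R) (fun j => (X j : R)) (M.map Int.cast) := by
  apply ext_succAbove i <;> simp

open scoped Classical in
theorem sum_kernel_apply_ne_zero_le {p : ℕ} [Fact p.Prime] (hp : 2 < p) {d e : ℕ} {s : ℝ}
    (hs : 0 < s) {β : ℝ} (hβ : β = s ^ 8) (hd1 : 2 ^ d * s ^ 4 ≤ 1) (hd2 : 1 ≤ 2 * 2 ^ d * s ^ 4)
    (i : Fin (d + e + 1)) :
    ∑ A ∈ signSymm (d + e + 1), (if ∃ v : Fin (d + e + 1) → ZMod p,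
        (A.map (Int.cast : ℤ → ZMod p)).mulVec v = 0 ∧ v i ≠ 0 then (1 : ℝ) else 0) ≤
      (signSymm (d + e + 1)).card *
        (3 * s / 2 + s ^ 8 + q p (d + e) β + 1 / (4 * s ^ 3) * q p (d + e) β) := by
  rw [sum_signSymm_succ i, card_signSymm_succ]
  set h : Matrix (Fin (d + e)) (Fin (d + e)) (ZMod p) → ℝ := fun A =>
    3 * s / 2 + s ^ 8 + structuredInd p β 0 A + 1 / (4 * s ^ 3) *
      ((∑ z : Fin d → ℤˣ, ∑ z' : Fin d → ℤˣ,
        structuredInd p β (Fin.append (signVec p z - signVec p z') 0) A) / (2 ^ d) ^ 2) with hh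
  have hM : ∀ M ∈ signSymm (d + e), ∑ x : ℤˣ, ∑ X : Fin (d + e) → ℤˣ,
      (if ∃ v : Fin (d + e + 1) → ZMod p,
        ((bordered i (x : ℤ) (fun j => (X j : ℤ)) M).map (Int.cast : ℤ → ZMod p)).mulVec v = 0 ∧
          v i ≠ 0 then (1 : ℝ) else 0) ≤
      2 * 2 ^ (d + e) * h (M.map (Int.cast : ℤ → ZMod p)) := by
    intro M hM
    have hsymm : (M.map (Int.cast : ℤ → ZMod p)).IsSymm := (mem_signSymm.1 hM).1.map _
    have hx : ∀ x ∈ (Finset.univ : Finset ℤˣ), ∑ X : Fin (d + e) → ℤˣ,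
        (if ∃ v : Fin (d + e + 1) → ZMod p,
          ((bordered i (x : ℤ) (fun j => (X j : ℤ)) M).map (Int.cast : ℤ → ZMod p)).mulVec v = 0 ∧
            v i ≠ 0 then (1 : ℝ) else 0) ≤
        2 ^ (d + e) * h (M.map (Int.cast : ℤ → ZMod p)) := by
      intro x _
      rw [Finset.sum_boole]
      refine le_trans ?_ (card_border_le hp hs hβ hd1 hd2 hsymm ((x : ℤ) : ZMod p))
      refine Nat.cast_le.2 (Finset.card_le_card fun X hX => ?_)
      simp only [Finset.mem_filter, Finset.mem_univ, true_and] at hX ⊢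
      obtain ⟨v, hv, hvi⟩ := hX
      rw [bordered_map_cast] at hv
      exact exists_mulVec_eq_of_bordered hv hvi
    refine (Finset.sum_le_card_nsmul _ _ _ hx).trans_eq ?_
    simp [mul_assoc]
  refine (Finset.sum_le_sum hM).trans ?_
  rw [← Finset.mul_sum, mul_assoc (2 * 2 ^ (d + e) : ℝ)]
  refine mul_le_mul_of_nonneg_left ?_ (by positivity)
  have hsum : ∑ M ∈ signSymm (d + e), ∑ z : Fin d → ℤˣ, ∑ z' : Fin d → ℤˣ,
      structuredInd p β (Fin.append (signVec p z - signVec p z') 0)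
        (M.map (Int.cast : ℤ → ZMod p)) ≤
      (2 ^ d) ^ 2 * (q p (d + e) β * (signSymm (d + e)).card) := by
    rw [Finset.sum_comm]
    have h1 : ∀ z ∈ (Finset.univ : Finset (Fin d → ℤˣ)), ∑ M ∈ signSymm (d + e),
        ∑ z' : Fin d → ℤˣ, structuredInd p β (Fin.append (signVec p z - signVec p z') 0)
          (M.map (Int.cast : ℤ → ZMod p)) ≤
        2 ^ d * (q p (d + e) β * (signSymm (d + e)).card) := by
      intro z _
      rw [Finset.sum_comm]
      refine (Finset.sum_le_card_nsmul _ _ _ fun z' _ => sum_structuredInd_le p β _).trans_eq ?_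
      simp
    refine (Finset.sum_le_card_nsmul _ _ _ h1).trans_eq ?_
    simp only [Finset.card_univ, Fintype.card_pi, Fintype.card_units_int, Finset.prod_const,
      Fintype.card_fin, nsmul_eq_mul]
    push_cast
    ring
  have h0 := sum_structuredInd_le p (m := d + e) β 0
  simp only [hh, Finset.sum_add_distrib, Finset.sum_const, nsmul_eq_mul, ← Finset.mul_sum,
    ← Finset.sum_div]
  have h2 := (div_le_iff₀' (by positivity : (0 : ℝ) < (2 ^ d) ^ 2)).2 hsum
  have h3 := mul_le_mul_of_nonneg_left h2 (by positivity : (0 : ℝ) ≤ 1 / (4 * s ^ 3))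
  linarith

open scoped Classical in
theorem two_mul_ite_det_eq_zero_le {p : ℕ} [Fact p.Prime] {n : ℕ}
    {A : Matrix (Fin n) (Fin n) ℤ} (hA : A ∈ signSymm n) :
    2 * (if A.det = 0 then (1 : ℝ) else 0) ≤ ∑ i, if ∃ v : Fin n → ZMod p,
        (A.map (Int.cast : ℤ → ZMod p)).mulVec v = 0 ∧ v i ≠ 0 then (1 : ℝ) else 0 := by
  split_ifs with hdet
  swap
  · rw [mul_zero]
    exact Finset.sum_nonneg fun i _ => by split_ifs <;> norm_num
  have hdet' : (A.map (Int.cast : ℤ → ZMod p)).det = 0 := by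
    have := (Int.castRingHom (ZMod p)).map_det A
    rw [hdet, map_zero] at this
    exact this.symm
  obtain ⟨v, hv, hv0⟩ := Matrix.exists_mulVec_eq_zero_iff.2 hdet'
  obtain ⟨i, hi⟩ := Function.ne_iff.1 hv
  have hj : ∃ j, j ≠ i ∧ v j ≠ 0 := by
    by_contra! hj
    have h := congrFun hv0 i
    rw [Matrix.mulVec, dotProduct, Finset.sum_eq_single i (fun j _ hji => by rw [hj j hji, mul_zero])
      (by simp)] at h
    rcases (mem_signSymm.1 hA).2 i i with h1 | h1 <;> simp [h1] at h <;> exact hi h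
  obtain ⟨j, hji, hj⟩ := hj
  rw [Finset.sum_boole, mul_one, ← Nat.cast_ofNat, Nat.cast_le, ← Finset.card_pair hji]
  apply Finset.card_le_card
  intro k hk
  rw [Finset.mem_filter]
  refine ⟨Finset.mem_univ _, v, hv0, ?_⟩
  rcases Finset.mem_insert.1 hk with rfl | hk
  · exact hj
  · rw [Finset.mem_singleton.1 hk]; exact hi

theorem symPr_le_one (n : ℕ) (P : Matrix (Fin n) (Fin n) ℤ → Prop) :
    symPr n {A | P A} ≤ 1 := by
  classical
  rw [symPr_eq_sum]
  refine div_le_one_of_le₀ ?_ (by positivity)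
  rw [Finset.sum_boole]
  exact_mod_cast Finset.card_filter_le _ _

theorem symPr_det_eq_zero_le {p : ℕ} [Fact p.Prime] (hp : 2 < p) {m : ℕ} (hm : 0 < m) {s : ℝ}
    (hs : 0 < s) :
    symPr (m + 1) {A | A.det = 0} ≤ (m + 1) * (s + q p m (s ^ 8) / s ^ 8) := by
  classical
  have hq := q_nonneg p m (s ^ 8)
  have hm1 : (1 : ℝ) ≤ m := by exact_mod_cast hm
  have hs8 : 0 < s ^ 8 := by positivity
  by_cases hs2 : 1 / 2 ≤ s
  · refine (symPr_le_one _ _).trans ?_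
    have : 0 ≤ q p m (s ^ 8) / s ^ 8 := by positivity
    nlinarith
  by_cases hsm : s ^ 8 ≤ 1 / 2 ^ m
  · refine (symPr_le_one _ _).trans ?_
    have h1 := half_le_q (p := p) hm hsm
    have h2 : s ^ 8 ≤ 1 / 2 := hsm.trans (by
      gcongr
      exact le_self_pow₀ one_le_two hm.ne')
    have h3 : 1 ≤ q p m (s ^ 8) / s ^ 8 := by
      rw [le_div_iff₀ hs8]; linarith
    nlinarith
  push Not at hs2 hsm
  have hs4 : 0 < s ^ 4 := by positivity
  have hle : 1 ≤ 1 / s ^ 4 := by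
    rw [le_div_iff₀ hs4, one_mul]
    exact pow_le_one₀ hs.le (by linarith)
  obtain ⟨d, hd1, hd2⟩ := exists_nat_pow_near hle (one_lt_two (α := ℝ))
  rw [le_div_iff₀ hs4] at hd1
  rw [div_lt_iff₀ hs4, pow_succ'] at hd2
  have hdm : d ≤ m := by
    have h1 : (2 : ℝ) ^ d < 2 ^ m := by
      rw [div_lt_iff₀ (by positivity)] at hsm
      have h2 : (1 : ℝ) ≤ 2 ^ d := one_le_pow₀ one_le_two
      have h3 : (2 ^ d * s ^ 4) * (2 ^ d * s ^ 4) ≤ 1 := mul_le_one₀ hd1 (by positivity) hd1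
      by_contra! hlt
      have h4 : s ^ 8 * 2 ^ m ≤ s ^ 8 * (2 ^ d * 2 ^ d) := by
        gcongr
        nlinarith
      nlinarith
    exact ((pow_lt_pow_iff_right₀ one_lt_two).1 h1).le
  obtain ⟨e, rfl⟩ := Nat.exists_eq_add_of_le hdm
  have hpos : (0 : ℝ) < (signSymm (d + e + 1)).card := by
    exact_mod_cast (signSymm_nonempty _).card_pos
  rw [symPr_eq_sum, div_le_iff₀ hpos]
  have h1 : 2 * ∑ A ∈ signSymm (d + e + 1), (if A.det = 0 then (1 : ℝ) else 0) ≤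
      (d + e + 1 : ℕ) * ((signSymm (d + e + 1)).card *
        (3 * s / 2 + s ^ 8 + q p (d + e) (s ^ 8) + 1 / (4 * s ^ 3) * q p (d + e) (s ^ 8))) := by
    rw [Finset.mul_sum]
    refine (Finset.sum_le_sum fun A hA => two_mul_ite_det_eq_zero_le (p := p) hA).trans ?_
    rw [Finset.sum_comm]
    refine (Finset.sum_le_card_nsmul _ _ _ fun i _ =>
      sum_kernel_apply_ne_zero_le hp hs rfl hd1 hd2.le i).trans_eq ?_
    simp
  set Q := q p (d + e) (s ^ 8)
  have h2 : 3 * s / 2 + s ^ 8 + Q + 1 / (4 * s ^ 3) * Q ≤ 2 * (s + Q / s ^ 8) := by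
    have h3 : s ^ 8 ≤ s / 2 := by
      have : s ^ 7 ≤ s := pow_le_of_le_one hs.le (by linarith) (by norm_num)
      nlinarith
    have h5 : 1 ≤ 1 / s ^ 8 := by
      rw [le_div_iff₀ hs8]; nlinarith
    have h6 : 1 / (4 * s ^ 3) ≤ 1 / s ^ 8 := by
      apply one_div_le_one_div_of_le hs8
      have h7 : s ^ 8 ≤ s ^ 3 := pow_le_pow_of_le_one hs.le (by linarith) (by norm_num)
      have : 0 < s ^ 3 := by positivity
      linarith
    have h8 : Q ≤ 1 / s ^ 8 * Q := le_mul_of_one_le_left hq h5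
    have h9 := mul_le_mul_of_nonneg_right h6 hq
    rw [div_eq_inv_mul Q, ← one_div]
    linarith
  have h3 : (d + e + 1 : ℕ) * ((signSymm (d + e + 1)).card *
        (3 * s / 2 + s ^ 8 + Q + 1 / (4 * s ^ 3) * Q)) ≤
      ((d + e + 1 : ℕ) : ℝ) * ((signSymm (d + e + 1)).card * (2 * (s + Q / s ^ 8))) := by
    gcongr
  push_cast at h1 h3 ⊢
  linarith

/-- **Lemma 3.1.** Let `n ≥ 1` and let `p > 2` be prime. Then for every `β > 0`,
`P(det M_n = 0) ≤ n ∑_{m=n-1}^{2n-3} (β^{1/8} + q_m(β)/β)`. -/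
theorem det_zero_le_sum_q
    (n p : ℕ) (hn : 0 < n) [Fact p.Prime] (hp2 : 2 < p) (β : ℝ) (hβ : 0 < β) :
    symPr n {A | A.det = 0} ≤
      n * ∑ m ∈ Finset.Icc (n - 1) (2 * n - 3),
        (β ^ ((1 : ℝ) / 8) + q p m β / β) := by
  obtain ⟨m, rfl⟩ := Nat.exists_eq_succ_of_ne_zero hn.ne'
  have hterm : ∀ k, 0 ≤ β ^ ((1 : ℝ) / 8) + q p k β / β := fun k => by
    have := q_nonneg p k β
    positivity
  rcases Nat.eq_zero_or_pos m with rfl | hm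
  · classical
    refine le_trans (le_of_eq ?_)
      (mul_nonneg (Nat.cast_nonneg _) (Finset.sum_nonneg fun k _ => hterm k))
    rw [symPr_eq_sum, Finset.sum_eq_zero, zero_div]
    intro A hA
    rw [if_neg]
    rcases (mem_signSymm.1 hA).2 0 0 with h | h <;> simp [h]
  · set s := β ^ ((1 : ℝ) / 8) with hs
    have hs0 : 0 < s := by positivity
    have hs8 : s ^ 8 = β := by
      rw [hs, ← Real.rpow_natCast, ← Real.rpow_mul hβ.le]
      norm_num
    have h := symPr_det_eq_zero_le hp2 hm hs0
    rw [hs8] at h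
    refine h.trans ?_
    push_cast
    gcongr
    exact Finset.single_le_sum (f := fun k => s + q p k β / β) (fun k _ => hterm k)
      (Finset.mem_Icc.2 (by omega))
end

section
/- Let μ ∈ (0, 1/4], let k be a positive integer, let p be a prime, and let v be a finite tuple over ℤ/pℤ. Then ρ_μ(v^k) ≤ ( ρ_μ(v)^{(k-1)/k} + 8/√(μ·k) ) · ρ_μ(v) + 1/p. -/
open scoped Pointwise

/-- The Fourier transform of the law of `X_μ(v)`, which is real since the steps are symmetric. -/
noncomputable def walkFourier {p : ℕ} [NeZero p] {ι : Type} [Fintype ι]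
    (μ : ℝ) (v : ι → ZMod p) (ξ : ZMod p) : ℝ :=
  ∏ i, (1 - μ + μ * (ZMod.stdAddChar (v i * ξ)).re)

/-- The quadratic energy controlling `-log (walkFourier μ v ξ)`. -/
noncomputable def walkEnergy {p : ℕ} [NeZero p] {ι : Type} [Fintype ι]
    (μ : ℝ) (v : ι → ZMod p) (ξ : ZMod p) : ℝ :=
  ∑ i, μ * (‖1 - ZMod.stdAddChar (v i * ξ)‖ ^ 2 / 2)

lemma AddChar.map_sum_eq_prod {A M ι : Type*} [AddCommMonoid A] [CommMonoid M] (ψ : AddChar A M)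
    (s : Finset ι) (f : ι → A) : ψ (∑ i ∈ s, f i) = ∏ i ∈ s, ψ (f i) :=
  map_prod ψ.toMonoidHom (fun i => Multiplicative.ofAdd (f i)) s

section Fourier

variable {p : ℕ} [NeZero p] {ι : Type} [Fintype ι]

lemma norm_one_sub_stdAddChar_sq (x : ZMod p) :
    ‖1 - ZMod.stdAddChar x‖ ^ 2 / 2 = 1 - (ZMod.stdAddChar x).re := by
  have h : ‖ZMod.stdAddChar x‖ ^ 2 = 1 := by rw [AddChar.norm_apply]; norm_num
  rw [Complex.sq_norm, Complex.normSq_apply] at *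
  simp only [Complex.sub_re, Complex.sub_im, Complex.one_re, Complex.one_im]
  linarith

lemma abs_re_stdAddChar_le (x : ZMod p) : |(ZMod.stdAddChar x).re| ≤ 1 :=
  (Complex.abs_re_le_norm _).trans (AddChar.norm_apply _ _).le

lemma norm_one_sub_stdAddChar_add_le (x y : ZMod p) :
    ‖1 - ZMod.stdAddChar (x + y)‖ ≤ ‖1 - ZMod.stdAddChar x‖ + ‖1 - ZMod.stdAddChar y‖ := by
  have h : 1 - ZMod.stdAddChar (x + y) =
      (1 - ZMod.stdAddChar x) + ZMod.stdAddChar x * (1 - ZMod.stdAddChar y) := by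
    rw [AddChar.map_add_eq_mul]; ring
  rw [h]
  refine (norm_add_le _ _).trans ?_
  rw [norm_mul, AddChar.norm_apply, one_mul]

lemma probX_eq_fourier [DecidableEq ι] (μ : ℝ) (v : ι → ZMod p) (x : ZMod p) :
    (p : ℂ) * probX μ v x =
      ∑ ξ, ZMod.stdAddChar (-(ξ * x)) * (walkFourier μ v ξ : ℂ) := by
  have hF : ∀ ξ, (walkFourier μ v ξ : ℂ) =
      ∑ ε : ι → ({-1, 0, 1} : Finset ℤ), ∏ i,
        ((if (ε i : ℤ) = 0 then 1 - μ else μ / 2 : ℝ) : ℂ) *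
          ZMod.stdAddChar (((ε i : ℤ) : ZMod p) * (v i * ξ)) := by
    intro ξ
    rw [walkFourier, Complex.ofReal_prod, ← Fintype.prod_sum (fun (i : ι) (a : ({-1, 0, 1} : Finset ℤ)) =>
      ((if (a : ℤ) = 0 then 1 - μ else μ / 2 : ℝ) : ℂ) *
        ZMod.stdAddChar (((a : ℤ) : ZMod p) * (v i * ξ)))]
    refine Finset.prod_congr rfl fun i _ => ?_
    rw [Finset.sum_coe_sort ({-1, 0, 1} : Finset ℤ) (fun a : ℤ =>
      ((if a = 0 then 1 - μ else μ / 2 : ℝ) : ℂ) *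
          ZMod.stdAddChar ((a : ZMod p) * (v i * ξ)))]
    have hre := Complex.add_conj (ZMod.stdAddChar (v i * ξ))
    rw [← AddChar.map_neg_eq_conj] at hre
    rw [Finset.sum_insert (by decide), Finset.sum_insert (by decide), Finset.sum_singleton]
    simp
    push_cast at hre
    linear_combination (-(μ : ℂ) / 2) * hre
  have hdelta : ∀ s : ZMod p, (p : ℂ) * (if s = x then 1 else 0) =
      ∑ ξ, ZMod.stdAddChar (-(ξ * x)) * ZMod.stdAddChar (s * ξ) := by
    intro s
    have := AddChar.sum_mulShift (s - x) (ZMod.isPrimitive_stdAddChar p)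
    simp_rw [← AddChar.map_add_eq_mul]
    rw [show (∑ ξ, ZMod.stdAddChar (-(ξ * x) + s * ξ)) = ∑ ξ, ZMod.stdAddChar (ξ * (s - x)) from
      Finset.sum_congr rfl fun ξ _ => by congr 1; ring, this]
    simp [sub_eq_zero, ZMod.card]
  simp_rw [hF, Finset.mul_sum]
  rw [Finset.sum_comm, probX, Complex.ofReal_sum, Finset.mul_sum]
  refine Finset.sum_congr rfl fun ε _ => ?_
  have h := hdelta (∑ i, ((ε i : ℤ) : ZMod p) * v i)
  have hprod : ∀ ξ, ∏ i, ((if (ε i : ℤ) = 0 then 1 - μ else μ / 2 : ℝ) : ℂ) *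
          ZMod.stdAddChar (((ε i : ℤ) : ZMod p) * (v i * ξ)) =
      (∏ i, ((if (ε i : ℤ) = 0 then 1 - μ else μ / 2 : ℝ) : ℂ)) *
        ZMod.stdAddChar ((∑ i, ((ε i : ℤ) : ZMod p) * v i) * ξ) := by
    intro ξ
    rw [Finset.prod_mul_distrib, Finset.sum_mul, AddChar.map_sum_eq_prod]
    simp_rw [mul_assoc]
  simp_rw [hprod]
  rw [Complex.ofReal_mul, Complex.ofReal_prod, mul_left_comm,
    show (((if (∑ i, ((ε i : ℤ) : ZMod p) * v i) = x then 1 else 0 : ℝ)) : ℂ) =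
      if (∑ i, ((ε i : ℤ) : ZMod p) * v i) = x then 1 else 0 by split_ifs <;> simp, h,
    Finset.mul_sum]
  exact Finset.sum_congr rfl fun ξ _ => by ring

section Bounds

variable {μ : ℝ} (hμ : μ ∈ Set.Ioc (0 : ℝ) (1 / 4)) (v : ι → ZMod p)
include hμ

lemma walkFourier_factor_bounds (x : ZMod p) :
    1 / 2 ≤ 1 - μ + μ * (ZMod.stdAddChar x).re ∧
      1 - μ + μ * (ZMod.stdAddChar x).re ≤ 1 := by
  have h := abs_le.1 (abs_re_stdAddChar_le x)
  obtain ⟨h0, h1⟩ := hμ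
  constructor <;> nlinarith

lemma walkFourier_pos (ξ : ZMod p) : 0 < walkFourier μ v ξ :=
  Finset.prod_pos fun i _ => by linarith [(walkFourier_factor_bounds hμ (v i * ξ)).1]

lemma walkFourier_le_one (ξ : ZMod p) : walkFourier μ v ξ ≤ 1 :=
  Finset.prod_le_one (fun i _ => by linarith [(walkFourier_factor_bounds hμ (v i * ξ)).1])
    fun i _ => (walkFourier_factor_bounds hμ (v i * ξ)).2

lemma rho_eq_walkFourier [DecidableEq ι] :
    p * rho μ v = ∑ ξ, walkFourier μ v ξ := by
  have hp0 : (0 : ℝ) < p := by exact_mod_cast NeZero.pos p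
  have h0 : p * probX μ v 0 = ∑ ξ, walkFourier μ v ξ := by
    have := probX_eq_fourier μ v 0
    simp only [mul_zero, neg_zero, AddChar.map_zero_eq_one, one_mul] at this
    exact_mod_cast this
  have hle : ∀ x, probX μ v x ≤ probX μ v 0 := by
    intro x
    refine le_of_mul_le_mul_left ?_ hp0
    rw [h0]
    calc p * probX μ v x ≤ ‖((p * probX μ v x : ℝ) : ℂ)‖ := by
          rw [Complex.norm_real]; exact le_abs_self _
      _ ≤ ∑ ξ, walkFourier μ v ξ := by
          push_cast
          rw [probX_eq_fourier]
          refine (norm_sum_le _ _).trans (Finset.sum_le_sum fun ξ _ => ?_)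
          rw [norm_mul, AddChar.norm_apply, one_mul, Complex.norm_real, Real.norm_eq_abs,
            abs_of_pos (walkFourier_pos hμ v ξ)]
  rw [← h0, rho]
  congr 1
  exact le_antisymm (ciSup_le hle) (le_ciSup (Set.finite_range (probX μ v)).bddAbove 0)

lemma walkFourier_le_exp_neg_walkEnergy (ξ : ZMod p) :
    walkFourier μ v ξ ≤ Real.exp (-walkEnergy μ v ξ) := by
  rw [walkEnergy, ← Finset.sum_neg_distrib, Real.exp_sum]
  refine Finset.prod_le_prod
    (fun i _ => by linarith [(walkFourier_factor_bounds hμ (v i * ξ)).1]) fun i _ => ?_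
  rw [norm_one_sub_stdAddChar_sq]
  have := Real.add_one_le_exp (-(μ * (1 - (ZMod.stdAddChar (v i * ξ)).re)))
  linarith

lemma exp_neg_two_mul_walkEnergy_le (ξ : ZMod p) :
    Real.exp (-(2 * walkEnergy μ v ξ)) ≤ walkFourier μ v ξ := by
  rw [walkEnergy, Finset.mul_sum, ← Finset.sum_neg_distrib, Real.exp_sum]
  refine Finset.prod_le_prod (fun i _ => (Real.exp_pos _).le) fun i _ => ?_
  rw [norm_one_sub_stdAddChar_sq]
  obtain ⟨hlo, hhi⟩ := walkFourier_factor_bounds hμ (v i * ξ)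
  set y := μ * (1 - (ZMod.stdAddChar (v i * ξ)).re) with hy
  have hfac : 1 - μ + μ * (ZMod.stdAddChar (v i * ξ)).re = 1 - y := by rw [hy]; ring
  rw [hfac] at hlo hhi ⊢
  have hexp := Real.add_one_le_exp (2 * y)
  rw [Real.exp_neg, inv_le_iff_one_le_mul₀ (Real.exp_pos _)]
  nlinarith

lemma walkEnergy_add_le {a : ℝ} (m : ℕ) {x y : ZMod p}
    (hx : walkEnergy μ v x ≤ m ^ 2 * a) (hy : walkEnergy μ v y ≤ a) :
    walkEnergy μ v (x + y) ≤ ((m + 1 : ℕ) : ℝ) ^ 2 * a := by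
  have key : m * walkEnergy μ v (x + y) ≤
      (m + 1) * walkEnergy μ v x + m * (m + 1) * walkEnergy μ v y := by
    simp only [walkEnergy, Finset.mul_sum]
    rw [← Finset.sum_add_distrib]
    refine Finset.sum_le_sum fun i _ => ?_
    have h := norm_one_sub_stdAddChar_add_le (v i * x) (v i * y)
    rw [← mul_add] at h
    set A := ‖1 - ZMod.stdAddChar (v i * x)‖
    set B := ‖1 - ZMod.stdAddChar (v i * y)‖
    have hsq : ‖1 - ZMod.stdAddChar (v i * (x + y))‖ ^ 2 ≤ (A + B) ^ 2 :=
      pow_le_pow_left₀ (norm_nonneg _) h 2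
    have hm : (m : ℝ) * ‖1 - ZMod.stdAddChar (v i * (x + y))‖ ^ 2 ≤
        (m + 1) * A ^ 2 + m * (m + 1) * B ^ 2 := by
      have := mul_le_mul_of_nonneg_left hsq (Nat.cast_nonneg (α := ℝ) m)
      nlinarith [sq_nonneg (A - m * B)]
    have := mul_le_mul_of_nonneg_left hm hμ.1.le
    linarith
  rcases Nat.eq_zero_or_pos m with rfl | hm
  · have hx0 : ∀ i, ‖1 - ZMod.stdAddChar (v i * x)‖ = 0 := by
      intro i
      have hnn : ∀ j ∈ Finset.univ, 0 ≤ μ * (‖1 - ZMod.stdAddChar (v j * x)‖ ^ 2 / 2) :=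
        fun j _ => mul_nonneg hμ.1.le (by positivity)
      have h0 : walkEnergy μ v x = 0 :=
        le_antisymm (by simpa using hx) (Finset.sum_nonneg hnn)
      have := (Finset.sum_eq_zero_iff_of_nonneg hnn).1 h0 i (Finset.mem_univ i)
      have hμ0 := hμ.1.ne'
      simpa [hμ0] using this
    refine le_trans (Finset.sum_le_sum fun i _ => ?_) (hy.trans (by simp))
    have h := norm_one_sub_stdAddChar_add_le (v i * x) (v i * y)
    rw [← mul_add, hx0, zero_add] at h
    have := hμ.1.le
    gcongr
  · have hm' : (0 : ℝ) < m := by exact_mod_cast hm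
    refine le_of_mul_le_mul_left (key.trans ?_) hm'
    push_cast
    nlinarith [mul_le_mul_of_nonneg_left hx (by positivity : (0 : ℝ) ≤ m + 1),
      mul_le_mul_of_nonneg_left hy (by positivity : (0 : ℝ) ≤ m * (m + 1))]

lemma walkEnergy_le_of_mem_nsmul {a : ℝ} {S : Finset (ZMod p)}
    (hS : ∀ x ∈ S, walkEnergy μ v x ≤ a) (m : ℕ) :
    ∀ x ∈ m • S, walkEnergy μ v x ≤ (m : ℝ) ^ 2 * a := by
  induction m with
  | zero => intro x hx; simp_all [walkEnergy]
  | succ m ih =>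
    intro x hx
    rw [succ_nsmul, Finset.mem_add] at hx
    obtain ⟨y, hy, z, hz, rfl⟩ := hx
    exact walkEnergy_add_le hμ v m (ih y hy) (hS z hz)

lemma pow_le_walkFourier_of_mem_nsmul {t : ℝ} (ht : 0 < t) {S : Finset (ZMod p)}
    (hS : ∀ x ∈ S, t ≤ walkFourier μ v x) (m : ℕ) {x : ZMod p} (hx : x ∈ m • S) :
    t ^ (2 * m ^ 2) ≤ walkFourier μ v x := by
  have hE : ∀ x ∈ S, walkEnergy μ v x ≤ -Real.log t := fun y hy => by
    have := (Real.log_le_iff_le_exp ht).2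
      ((hS y hy).trans (walkFourier_le_exp_neg_walkEnergy hμ v y))
    linarith
  have h := walkEnergy_le_of_mem_nsmul hμ v hE m x hx
  refine le_trans ?_ (exp_neg_two_mul_walkEnergy_le hμ v x)
  rw [← Real.log_le_iff_le_exp (by positivity), Real.log_pow]
  push_cast
  linarith

end Bounds

end Fourier

lemma ZMod.cauchy_davenport_nsmul {p : ℕ} (hp : p.Prime) {S : Finset (ZMod p)}
    (hS : S.Nonempty) (m : ℕ) : min p (m * (S.card - 1) + 1) ≤ (m • S).card := by
  induction m with
  | zero => simp
  | succ m ih =>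
    have h := ZMod.cauchy_davenport hp (hS.nsmul (n := m)) hS
    rw [succ_nsmul]
    have := hS.card_pos
    rw [add_mul]
    omega

/-- If the `j`-th largest weight is at most `min 1 ((K / j) ^ 2)`, the weights sum to at
most `4 * K`. -/
lemma sum_le_of_rank_mul_sqrt_le {α : Type*} {K : ℝ} (hK : 0 < K)
    (w : α → ℝ) (T : Finset α) (h0 : ∀ x ∈ T, 0 ≤ w x) (h1 : ∀ x ∈ T, w x ≤ 1)
    (h : ∀ x ∈ T, ((T.filter fun y => w x ≤ w y).card : ℝ) * √(w x) ≤ K) :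
    ∑ x ∈ T, w x ≤ 4 * K - 4 * K ^ 2 / (K + T.card) := by
  classical
  induction T using Finset.induction_on_min_value w with
  | empty => simp; field_simp; simp
  | insert a s ha hmin ih =>
    have hs := ih (fun x hx => h0 x (Finset.mem_insert_of_mem hx))
      (fun x hx => h1 x (Finset.mem_insert_of_mem hx)) fun x hx => by
        refine le_trans ?_ (h x (Finset.mem_insert_of_mem hx))
        gcongr
        exact Finset.subset_insert _ _
    have hfilter : ((insert a s).filter fun y => w a ≤ w y) = insert a s :=
      Finset.filter_true_of_mem fun y hy => by
        rcases Finset.mem_insert.1 hy with rfl | hy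
        · exact le_rfl
        · exact hmin y hy
    have hr := h a (Finset.mem_insert_self a s)
    rw [hfilter, Finset.card_insert_of_notMem ha] at hr
    rw [Finset.sum_insert ha, Finset.card_insert_of_notMem ha]
    have ha0 := h0 a (Finset.mem_insert_self a s)
    have hsqrt1 : √(w a) ≤ 1 := Real.sqrt_le_one.2 (h1 a (Finset.mem_insert_self a s))
    have hbound : √(w a) * (K + (s.card + 1 : ℝ)) ≤ 2 * K := by
      push_cast at hr; nlinarith
    have hc : (0 : ℝ) ≤ s.card := Nat.cast_nonneg _
    have hwa : w a * (K + (s.card + 1 : ℝ)) ^ 2 ≤ 4 * K ^ 2 := by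
      have h2 := pow_le_pow_left₀ (by positivity) hbound 2
      rw [mul_pow, Real.sq_sqrt ha0] at h2
      linarith
    have hwa' : w a ≤ 4 * K ^ 2 / (K + s.card) - 4 * K ^ 2 / (K + (s.card + 1)) := by
      rw [div_sub_div _ _ (by positivity) (by positivity), le_div_iff₀ (by positivity)]
      nlinarith [mul_nonneg ha0 (by positivity : (0 : ℝ) ≤ K + (s.card + 1))]
    push_cast
    linarith

section Main

variable {p : ℕ} [Fact p.Prime] {ι : Type} [Fintype ι] [DecidableEq ι]
  {μ : ℝ} (hμ : μ ∈ Set.Ioc (0 : ℝ) (1 / 4)) (v : ι → ZMod p)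
include hμ

lemma rho_pos : 0 < rho μ v := by
  have hp : (0 : ℝ) < p := by exact_mod_cast (Fact.out : p.Prime).pos
  refine (mul_pos_iff_of_pos_left hp).1 ?_
  rw [rho_eq_walkFourier hμ v]
  exact Finset.sum_pos (fun ξ _ => walkFourier_pos hμ v ξ) Finset.univ_nonempty

lemma card_levelSet_mul_sqrt_le {k m : ℕ} (hmk : 4 * m ^ 2 ≤ k) {t : ℝ}
    (ht0 : 0 < t) (ht1 : t ≤ 1) (htρ : rho μ v < t ^ k) :
    m * ((Finset.univ.filter fun y => y ≠ 0 ∧ t ≤ walkFourier μ v y).card : ℝ) * √(t ^ k) ≤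
      p * rho μ v := by
  classical
  have hp : p.Prime := Fact.out
  have hp0 : (0 : ℝ) < p := by exact_mod_cast hp.pos
  set R := Finset.univ.filter fun y => y ≠ 0 ∧ t ≤ walkFourier μ v y with hR
  have hR0 : (0 : ZMod p) ∉ R := by simp [hR]
  have hS : ∀ x ∈ insert 0 R, t ≤ walkFourier μ v x := by
    intro x hx
    rcases Finset.mem_insert.1 hx with rfl | hx
    · simpa [walkFourier] using ht1
    · exact (Finset.mem_filter.1 hx).2.2
  have hlow : ∀ x ∈ m • insert 0 R, √(t ^ k) ≤ walkFourier μ v x := fun x hx => by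
    refine le_trans ?_ (pow_le_walkFourier_of_mem_nsmul hμ v ht0 hS m hx)
    rw [Real.sqrt_le_left (by positivity), ← pow_mul]
    exact pow_le_pow_of_le_one ht0.le ht1 (by linarith)
  have hcard : ((m • insert 0 R).card : ℝ) * √(t ^ k) ≤ p * rho μ v := by
    rw [rho_eq_walkFourier hμ v, ← nsmul_eq_mul]
    exact (Finset.card_nsmul_le_sum _ _ _ hlow).trans
      (Finset.sum_le_univ_sum_of_nonneg fun ξ => (walkFourier_pos hμ v ξ).le)
  have hsqrt : t ^ k ≤ √(t ^ k) :=
    Real.le_sqrt_of_sq_le (by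
      have := pow_le_one₀ ht0.le ht1 (n := k)
      have : 0 < t ^ k := by positivity
      nlinarith)
  have hCD := ZMod.cauchy_davenport_nsmul hp (Finset.insert_nonempty 0 R) m
  rw [Finset.card_insert_of_notMem hR0, Nat.add_sub_cancel] at hCD
  rcases le_or_gt p (m * R.card + 1) with hle | hlt
  · rw [min_eq_left hle] at hCD
    have : (p : ℝ) ≤ (m • insert 0 R).card := by exact_mod_cast hCD
    have := mul_le_mul_of_nonneg_right this (Real.sqrt_nonneg (t ^ k))
    have := mul_lt_mul_of_pos_left (htρ.trans_le hsqrt) hp0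
    linarith
  · rw [min_eq_right hlt.le] at hCD
    refine le_trans ?_ hcard
    gcongr
    exact_mod_cast (Nat.le_succ _).trans hCD

lemma sum_walkFourier_pow_large_le {k m : ℕ} (hm : 0 < m) (hmk : 4 * m ^ 2 ≤ k) :
    ∑ ξ with ξ ≠ 0 ∧ rho μ v < walkFourier μ v ξ ^ k, walkFourier μ v ξ ^ k ≤
      4 * (p * rho μ v / m) := by
  have hp0 : (0 : ℝ) < p := by exact_mod_cast (Fact.out : p.Prime).pos
  have hm0 : (0 : ℝ) < m := by exact_mod_cast hm
  have hK : 0 < p * rho μ v / m := by have := rho_pos hμ v; positivity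
  have hk : k ≠ 0 := by have := pow_pos hm 2; omega
  refine (sum_le_of_rank_mul_sqrt_le hK (fun ξ => walkFourier μ v ξ ^ k) _
    (fun x _ => pow_nonneg (walkFourier_pos hμ v x).le k)
    (fun x _ => pow_le_one₀ (walkFourier_pos hμ v x).le (walkFourier_le_one hμ v x))
    fun x hx => ?_).trans (sub_le_self _ (by positivity))
  have h := card_levelSet_mul_sqrt_le hμ v hmk (walkFourier_pos hμ v x)
    (walkFourier_le_one hμ v x) (Finset.mem_filter.1 hx).2.2
  rw [le_div_iff₀ hm0]
  refine le_trans ?_ h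
  rw [mul_comm, ← mul_assoc]
  gcongr
  intro y hy
  simp only [Finset.mem_filter, Finset.mem_univ, true_and] at hy ⊢
  exact ⟨hy.1.1, (pow_le_pow_iff_left₀ (walkFourier_pos hμ v x).le
    (walkFourier_pos hμ v y).le hk).1 hy.2⟩

lemma sum_walkFourier_pow_small_le {k : ℕ} (hk : 0 < k) :
    ∑ ξ with walkFourier μ v ξ ^ k ≤ rho μ v, walkFourier μ v ξ ^ k ≤
      rho μ v ^ (((k : ℝ) - 1) / k) * (p * rho μ v) := by
  have hρ := rho_pos hμ v
  have hk1 : (1 : ℝ) ≤ k := by exact_mod_cast hk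
  rw [rho_eq_walkFourier hμ v, Finset.mul_sum]
  refine (Finset.sum_le_sum fun ξ hξ => ?_).trans
    (Finset.sum_le_univ_sum_of_nonneg fun ξ =>
      mul_nonneg (Real.rpow_nonneg hρ.le _) (walkFourier_pos hμ v ξ).le)
  have hf := walkFourier_pos hμ v ξ
  have h : (walkFourier μ v ξ ^ k) ^ (((k : ℝ) - 1) / k) = walkFourier μ v ξ ^ (k - 1) := by
    rw [← Real.rpow_natCast, ← Real.rpow_mul hf.le, mul_div_cancel₀ _ (by positivity),
      ← Real.rpow_natCast, Nat.cast_sub hk, Nat.cast_one]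
  rw [← Nat.sub_add_cancel hk, pow_succ, Nat.sub_add_cancel hk, ← h]
  have hexp : 0 ≤ ((k : ℝ) - 1) / k := div_nonneg (by linarith) (by linarith)
  gcongr
  exact (Finset.mem_filter.1 hξ).2

end Main

/-- **Lemma 4.1.** Let `μ ∈ (0, 1/4]`, `k ≥ 1`, `p` prime, and let `v` be a tuple over `ℤ/pℤ`.
Then `ρ_μ(v^k) ≤ (ρ_μ(v)^{(k-1)/k} + 8/√(μk)) ρ_μ(v) + 1/p`, where `v^k` is the concatenation
of `k` copies of `v`. -/
theorem rho_pow_le_of_small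
    (μ : ℝ) (hμ : μ ∈ Set.Ioc (0 : ℝ) (1 / 4)) (k : ℕ) (hk : 0 < k) (p n : ℕ)
    [Fact p.Prime] (v : Fin n → ZMod p) :
    rho μ (fun x : Fin n × Fin k => v x.1) ≤
      (rho μ v ^ (((k : ℝ) - 1) / k) + 8 / Real.sqrt (μ * k)) * rho μ v + 1 / p := by
  have hp : p.Prime := Fact.out
  have hp0 : (0 : ℝ) < p := by exact_mod_cast hp.pos
  have hk0 : (0 : ℝ) < k := by exact_mod_cast hk
  have hμ0 := hμ.1
  have hρ := rho_pos hμ v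
  have hpow : p * rho μ (fun x : Fin n × Fin k => v x.1) = ∑ ξ, walkFourier μ v ξ ^ k := by
    rw [rho_eq_walkFourier hμ _]
    refine Finset.sum_congr rfl fun ξ _ => ?_
    simp [walkFourier, Fintype.prod_prod_type, Finset.prod_pow]
  have hconst : 16 / √k ≤ 8 / √(μ * k) := by
    rw [div_le_div_iff₀ (by positivity) (by positivity)]
    have : √(μ * k) ≤ √k / 2 := by
      rw [Real.sqrt_le_left (by positivity), div_pow, Real.sq_sqrt hk0.le]
      nlinarith [hμ.2]
    linarith
  refine le_of_mul_le_mul_left ?_ hp0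
  rw [hpow]
  have hrhs : p * ((rho μ v ^ (((k : ℝ) - 1) / k) + 8 / √(μ * k)) * rho μ v + 1 / p) =
      rho μ v ^ (((k : ℝ) - 1) / k) * (p * rho μ v) + 8 / √(μ * k) * (p * rho μ v) + 1 := by
    field_simp
  rw [hrhs]
  have hpρ : 0 < p * rho μ v := by positivity
  rcases le_or_gt k 16 with hk16 | hk16
  · have h1 : 1 ≤ 16 / √k := by
      rw [one_le_div (by positivity), Real.sqrt_le_left (by norm_num)]
      have : (k : ℝ) ≤ 16 := by exact_mod_cast hk16
      linarith
    have h2 : ∑ ξ, walkFourier μ v ξ ^ k ≤ p * rho μ v := by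
      rw [rho_eq_walkFourier hμ v]
      exact Finset.sum_le_sum fun ξ _ =>
        pow_le_of_le_one (walkFourier_pos hμ v ξ).le (walkFourier_le_one hμ v ξ) hk.ne'
    have h3 : 0 ≤ rho μ v ^ (((k : ℝ) - 1) / k) * (p * rho μ v) := by positivity
    have h4 := mul_le_mul_of_nonneg_right (h1.trans hconst) hpρ.le
    linarith
  · set m := ⌊√k / 2⌋₊ with hm
    have hsqrt : 4 ≤ √(k : ℝ) := Real.le_sqrt_of_sq_le (by
      have : (16 : ℝ) < k := by exact_mod_cast hk16
      linarith)
    have hm1 : (m : ℝ) ≤ √k / 2 := Nat.floor_le (by positivity)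
    have hm2 : √k / 2 < m + 1 := Nat.lt_floor_add_one _
    have hm3 : √k / 4 ≤ m := by linarith
    have hm0 : (0 : ℝ) < m := by linarith
    have hmk : 4 * m ^ 2 ≤ k := by
      have : (4 : ℝ) * m ^ 2 ≤ k := by
        nlinarith [Real.sq_sqrt hk0.le]
      exact_mod_cast this
    have hlarge := sum_walkFourier_pow_large_le hμ v (Nat.cast_pos.1 hm0) hmk
    have hsmall := sum_walkFourier_pow_small_le hμ v hk
    have hfour : 4 * (p * rho μ v / m) ≤ 8 / √(μ * k) * (p * rho μ v) := by
      refine le_trans ?_ (mul_le_mul_of_nonneg_right hconst hpρ.le)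
      rw [mul_div_left_comm, mul_comm]
      gcongr ?_ * _
      rw [div_le_div_iff₀ hm0 (by positivity)]
      linarith
    have hsplit : ∑ ξ, walkFourier μ v ξ ^ k ≤
        ∑ ξ with walkFourier μ v ξ ^ k ≤ rho μ v, walkFourier μ v ξ ^ k +
        ∑ ξ with ξ ≠ 0 ∧ rho μ v < walkFourier μ v ξ ^ k, walkFourier μ v ξ ^ k + 1 := by
      have hzero : ∑ ξ : ZMod p, (if ξ = 0 then (1 : ℝ) else 0) = 1 := by simp
      rw [Finset.sum_filter, Finset.sum_filter, ← hzero, ← Finset.sum_add_distrib,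
        ← Finset.sum_add_distrib]
      refine Finset.sum_le_sum fun ξ _ => ?_
      have hf := (walkFourier_pos hμ v ξ).le
      have := pow_nonneg hf k
      have := pow_le_one₀ hf (walkFourier_le_one hμ v ξ) (n := k)
      rcases eq_or_ne ξ 0 with h0 | h0 <;>
        rcases le_or_gt (walkFourier μ v ξ ^ k) (rho μ v) with h1 | h1
      all_goals split_ifs <;> grind
    linarith
end

section
/- For every μ ∈ [0, 1/4] and every real number t, one has μ·‖t‖_𝕋² ≤ -log(1 - μ + μ·cos(2π·t)) ≤ 32·μ·‖t‖_𝕋², where ‖t‖_𝕋 denotes the distance from t to the nearest integer. -/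
/-- The chord of `-log` between `1/2` and `1` lies above its graph. -/
theorem neg_log_one_sub_le {u : ℝ} (h0 : 0 ≤ u) (h1 : u ≤ 1 / 2) :
    -Real.log (1 - u) ≤ 2 * Real.log 2 * u := by
  have h := strictConcaveOn_log_Ioi.concaveOn.2 (show (1 : ℝ) ∈ Set.Ioi 0 by simp)
    (show (1 / 2 : ℝ) ∈ Set.Ioi 0 by simp) (show 0 ≤ 1 - 2 * u by linarith)
    (show 0 ≤ 2 * u by linarith) (by ring)
  simp only [smul_eq_mul, Real.log_one, one_div, Real.log_inv] at h
  rw [show (1 - 2 * u) * 1 + 2 * u * 2⁻¹ = 1 - u by ring] at h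
  linarith

/-- **Inequality (4.3).** For every `μ ∈ [0, 1/4]` and every real `t`,
`μ ‖t‖_𝕋² ≤ -log(1 - μ + μ cos(2πt)) ≤ 32 μ ‖t‖_𝕋²`, where `‖t‖_𝕋 = |t - round t|` is the
distance from `t` to the nearest integer. -/
theorem log_cos_bounds (μ : ℝ) (hμ : μ ∈ Set.Icc (0 : ℝ) (1 / 4)) (t : ℝ) :
    μ * |t - round t| ^ 2 ≤ -Real.log (1 - μ + μ * Real.cos (2 * Real.pi * t)) ∧
    -Real.log (1 - μ + μ * Real.cos (2 * Real.pi * t)) ≤ 32 * μ * |t - round t| ^ 2 := by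
  obtain ⟨hμ0, hμ1⟩ := hμ
  have hcos : Real.cos (2 * Real.pi * t) = Real.cos (2 * Real.pi * (t - round t)) := by
    rw [← Real.cos_sub_int_mul_two_pi _ (round t)]
    ring_nf
  have hs := abs_sub_round t
  rw [hcos, sq_abs]
  generalize t - round t = s at hs ⊢
  have hπ := Real.pi_pos
  have hup : Real.cos (2 * Real.pi * s) ≤ 1 - 8 * s ^ 2 := by
    have h := Real.cos_le_one_sub_mul_cos_sq (x := 2 * Real.pi * s) (by
      rw [abs_mul, abs_of_pos (by positivity)]
      nlinarith)
    convert h using 2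
    field_simp
    ring
  have hlow : 1 - 2 * Real.pi ^ 2 * s ^ 2 ≤ Real.cos (2 * Real.pi * s) := by
    have h := Real.one_sub_sq_div_two_le_cos (x := 2 * Real.pi * s)
    linarith
  have hge := Real.neg_one_le_cos (2 * Real.pi * s)
  generalize Real.cos (2 * Real.pi * s) = c at *
  have hμs : 0 ≤ μ * s ^ 2 := by positivity
  have hu1 : 8 * (μ * s ^ 2) ≤ μ * (1 - c) := by nlinarith
  rw [show 1 - μ + μ * c = 1 - μ * (1 - c) by ring]
  have hu2 : μ * (1 - c) ≤ 1 / 2 := by nlinarith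
  constructor
  · have h := Real.log_le_sub_one_of_pos (x := 1 - μ * (1 - c)) (by linarith)
    linarith
  · have hu3 : μ * (1 - c) ≤ 20 * (μ * s ^ 2) := by
      have hsq : Real.pi ^ 2 ≤ 10 := by nlinarith [Real.pi_lt_d2]
      have h : μ * (1 - c) ≤ μ * (2 * Real.pi ^ 2 * s ^ 2) :=
        mul_le_mul_of_nonneg_left (by linarith) hμ0
      nlinarith
    have hlog : Real.log 2 ≤ 7 / 10 := by linarith [Real.log_two_lt_d9]
    have h := neg_log_one_sub_le (by linarith) hu2
    nlinarith
end
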